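/- Let p ∈ [1,∞) and let Q ∈ L_p(M₂) be a Dirac-form potential. Let K_Q be the (necessarily unique) kernel, supported on the triangle {0 ≤ t ≤ x ≤ 1}, for which c(x,λ) = c₀(x,λ) + ∫₀ˣ K_Q(x,t) c₀(t,λ) dt holds for all λ ∈ ℂ and all x ∈ [0,1]. Then K_Q belongs to G_p(M₂), and the map Q ↦ K_Q from Dirac-form potentials in L_p(M₂) into G_p(M₂) is continuous. -/

import Mathlib

open MeasureTheory Complex Filter Set
open scoped Matrix.Norms.L2Operator ENNReal

noncomputable section

abbrev M2 := Matrix (Fin 2) (Fin 2) ℂ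

def Bmat : M2 := !![0, 1; -1, 0]

def Jmat : M2 := !![1, 0; 0, -1]

/-- `expB τ = e^{-τ B} = [[cos τ, -sin τ],[sin τ, cos τ]]`. -/
def expB (τ : ℂ) : M2 := !![Complex.cos τ, -Complex.sin τ; Complex.sin τ, Complex.cos τ]

/-- Lebesgue measure restricted to `(0,1)`. -/
def μ01 : Measure ℝ := volume.restrict (Set.Ioo 0 1)

/-- Lebesgue measure restricted to `(-1,1)`. -/
def μ11 : Measure ℝ := volume.restrict (Set.Ioo (-1) 1)

/-- A Dirac-form potential `Q = [[q₁,q₂],[q₂,-q₁]]`. -/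
def IsDiracForm (Q : ℝ → M2) : Prop :=
  ∃ q1 q2 : ℝ → ℂ, ∀ x, Q x = !![q1 x, q2 x; q2 x, -q1 x]

/-- A Dirac-form potential with real-valued entries. -/
def IsRealDiracForm (Q : ℝ → M2) : Prop :=
  ∃ q1 q2 : ℝ → ℝ, ∀ x, Q x = !![(q1 x : ℂ), (q2 x : ℂ); (q2 x : ℂ), -(q1 x : ℂ)]

/-- `U` is an absolutely continuous matrix solution of `B U' + Q U = λ U` a.e. on `(0,1)`. -/
def IsMatSolution (Q : ℝ → M2) (l : ℂ) (U : ℝ → M2) : Prop :=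
  ∃ U' : ℝ → M2, IntegrableOn U' (Set.Ioo 0 1) ∧
    (∀ x ∈ Set.Icc (0:ℝ) 1, U x = U 0 + ∫ t in (0:ℝ)..x, U' t) ∧
    (∀ᵐ x ∂μ01, Bmat * U' x + Q x * U x = l • U x)

/-- `u` is an absolutely continuous `ℂ²`-valued solution of `B u' + Q u = λ u` a.e. on `(0,1)`. -/
def IsVecSolution (Q : ℝ → M2) (l : ℂ) (u : ℝ → Fin 2 → ℂ) : Prop :=
  ∃ u' : ℝ → Fin 2 → ℂ, IntegrableOn u' (Set.Ioo 0 1) ∧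
    (∀ x ∈ Set.Icc (0:ℝ) 1, u x = u 0 + ∫ t in (0:ℝ)..x, u' t) ∧
    (∀ᵐ x ∂μ01, Bmat.mulVec (u' x) + (Q x).mulVec (u x) = l • u x)

/-- `λ` is an eigenvalue of the Dirac operator `A_j` (`j = 0` for `A₁`, `j = 1` for `A₂`):
there is a nonzero AC solution with `u₂(0) = 0` and `u_j(1) = 0`. -/
def IsEigenvalue (Q : ℝ → M2) (j : Fin 2) (l : ℝ) : Prop :=
  ∃ u : ℝ → Fin 2 → ℂ, IsVecSolution Q (l : ℂ) u ∧
    (∃ x ∈ Set.Icc (0:ℝ) 1, u x ≠ 0) ∧ u 0 1 = 0 ∧ u 1 j = 0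

/-- `c₀(·,λ) = (cos λx, sin λx)ᵗ`. -/
def c0 (l : ℂ) (x : ℝ) : Fin 2 → ℂ := ![Complex.cos (l * x), Complex.sin (l * x)]

/-- n-th Fourier coefficient `e_n(g) = ∫₀¹ e^{-2πinx} g(x) dx`. -/
def fc (g : ℝ → ℂ) (n : ℤ) : ℂ :=
  ∫ x in (0:ℝ)..1, Complex.exp (-2 * Real.pi * Complex.I * n * x) * g x

/-- The square of the `ℍ = L₂((0,1),ℂ²)` norm of `u`. -/
def hnormSq (u : ℝ → Fin 2 → ℂ) : ℝ :=
  ∫ x in Set.Ioo (0:ℝ) 1, (‖u x 0‖ ^ 2 + ‖u x 1‖ ^ 2)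

/-- The `ℂ²` inner product `⟨v,w⟩ = v₁ w̄₁ + v₂ w̄₂`. -/
def ip2 (v w : Fin 2 → ℂ) : ℂ := v 0 * star (w 0) + v 1 * star (w 1)

/-- The eigenvalue asymptotics `λ_n = π(n+1/2) + e_n(g)` for some `g ∈ L_p(0,1)`. -/
def LamAsymp (p : ℝ≥0∞) (lam : ℤ → ℝ) : Prop :=
  ∃ g : ℝ → ℂ, MemLp g p μ01 ∧
    ∀ n : ℤ, (lam n : ℂ) = Real.pi * (n + 1/2) + fc g n

/-- The eigenvalue asymptotics `μ_n = πn + e_n(g)` for some `g ∈ L_p(0,1)`. -/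
def MuAsymp (p : ℝ≥0∞) (mu : ℤ → ℝ) : Prop :=
  ∃ g : ℝ → ℂ, MemLp g p μ01 ∧
    ∀ n : ℤ, (mu n : ℂ) = Real.pi * n + fc g n

/-- The norming-constant asymptotics `α_n = 1 + e_n(g)` for some `g ∈ L_p(0,1)`. -/
def AlAsymp (p : ℝ≥0∞) (al : ℤ → ℝ) : Prop :=
  ∃ g : ℝ → ℂ, MemLp g p μ01 ∧ ∀ n : ℤ, (al n : ℂ) = 1 + fc g n

/-- Membership in the class `SD_p` of spectral data. -/
def MemSD (p : ℝ≥0∞) (lam mu : ℤ → ℝ) : Prop :=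
  (∀ n : ℤ, lam (n - 1) < mu n ∧ mu n < lam n) ∧ LamAsymp p lam ∧ MuAsymp p mu

/-- Membership in the kernel space `G_p(M₂)`: all slices lie in `L_p` and the slice maps are
continuous from `[0,1]` to `L_p((0,1),M₂)`. -/
def MemGp (p : ℝ≥0∞) (K : ℝ → ℝ → M2) : Prop :=
  (∀ x ∈ Set.Icc (0:ℝ) 1, MemLp (K x) p μ01) ∧
  (∀ t ∈ Set.Icc (0:ℝ) 1, MemLp (fun x => K x t) p μ01) ∧
  (∀ x₀ ∈ Set.Icc (0:ℝ) 1, ∀ ε > (0:ℝ), ∃ δ > (0:ℝ), ∀ x ∈ Set.Icc (0:ℝ) 1,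
    |x - x₀| < δ → eLpNorm (fun t => K x t - K x₀ t) p μ01 < ENNReal.ofReal ε) ∧
  (∀ t₀ ∈ Set.Icc (0:ℝ) 1, ∀ ε > (0:ℝ), ∃ δ > (0:ℝ), ∀ t ∈ Set.Icc (0:ℝ) 1,
    |t - t₀| < δ → eLpNorm (fun x => K x t - K x t₀) p μ01 < ENNReal.ofReal ε)

/-- The norm of the space `G_p(M₂)` (as an extended real number). -/
def gpNorm (p : ℝ≥0∞) (K : ℝ → ℝ → M2) : ℝ≥0∞ :=
  max (⨆ x ∈ Set.Icc (0:ℝ) 1, eLpNorm (K x) p μ01)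
      (⨆ t ∈ Set.Icc (0:ℝ) 1, eLpNorm (fun x => K x t) p μ01)


/-- `K` is the kernel of the transformation operator for `Q`: it is supported on the
triangle `{0 ≤ t ≤ x ≤ 1}` and realizes the representation
`c(x,λ) = c₀(x,λ) + ∫₀ˣ K(x,t) c₀(t,λ) dt` for all `λ`. -/
def IsTransfKernel (Q : ℝ → M2) (K : ℝ → ℝ → M2) : Prop :=
  (∀ x t : ℝ, ¬ (0 ≤ t ∧ t ≤ x ∧ x ≤ 1) → K x t = 0) ∧
  ∀ l : ℂ, ∀ c : ℝ → Fin 2 → ℂ, IsVecSolution Q l c → c 0 = ![1, 0] →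
    ∀ x ∈ Set.Icc (0:ℝ) 1,
      c x = c0 l x + ∫ t in (0:ℝ)..x, (K x t).mulVec (c0 l t)

open scoped Topology BoundedContinuousFunction

section gen
set_option linter.unusedSectionVars false
variable {R : Type*} [NormedRing R] [NormedAlgebra ℝ R]

def kG (w : ℝ → R) (x t : ℝ) : R := if |t| < x then (1/2 : ℝ) • w ((x - t)/2) else 0
def kT (w : ℝ → R) (N : ℝ → ℝ → R) (x t : ℝ) : R := ∫ s in Ioo 0 x, w s * N s (x - s - t)
def kN (w : ℝ → R) : ℕ → ℝ → ℝ → R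
  | 0 => kG w
  | n+1 => kT w (kN w n)
def kS (w : ℝ → R) (x t : ℝ) : R := ∑' n, kN w n x t

theorem kG_meas {w : ℝ → R} (hw : Continuous w) : StronglyMeasurable (Function.uncurry (kG w)) := by
  unfold kG Function.uncurry
  refine StronglyMeasurable.ite ?_ ?_ stronglyMeasurable_const
  · exact measurableSet_lt (by fun_prop) (by fun_prop)
  · have : Continuous (fun a : ℝ × ℝ => (1/2 : ℝ) • w ((a.1 - a.2)/2)) := by fun_prop
    exact this.stronglyMeasurable

theorem kT_eq (w : ℝ → R) (N : ℝ → ℝ → R) (x t : ℝ) :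
    kT w N x t = ∫ s, (Ioo 0 x).indicator (fun s => w s * N s (x - s - t)) s := by
  rw [integral_indicator measurableSet_Ioo]; rfl

theorem kT_int_meas {w : ℝ → R} (hw : Continuous w) {N : ℝ → ℝ → R}
    (hN : StronglyMeasurable (Function.uncurry N)) :
    StronglyMeasurable (fun a : (ℝ × ℝ) × ℝ =>
      (Ioo 0 a.1.1).indicator (fun s => w s * N s (a.1.1 - s - a.1.2)) a.2) := by
  have h1 : StronglyMeasurable (fun a : (ℝ × ℝ) × ℝ => w a.2 * N a.2 (a.1.1 - a.2 - a.1.2)) := by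
    refine StronglyMeasurable.mul (hw.stronglyMeasurable.comp_measurable measurable_snd) ?_
    exact hN.comp_measurable (g := fun a : (ℝ × ℝ) × ℝ => (a.2, a.1.1 - a.2 - a.1.2)) (by fun_prop)
  have hS : MeasurableSet {a : (ℝ × ℝ) × ℝ | 0 < a.2 ∧ a.2 < a.1.1} :=
    (measurableSet_lt measurable_const measurable_snd).inter
      (measurableSet_lt measurable_snd (measurable_fst.comp measurable_fst))
  exact h1.indicator hS

theorem kT_meas {w : ℝ → R} (hw : Continuous w) {N : ℝ → ℝ → R}
    (hN : StronglyMeasurable (Function.uncurry N)) :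
    StronglyMeasurable (Function.uncurry (kT w N)) := by
  have := (kT_int_meas hw hN).integral_prod_right' (ν := (volume : Measure ℝ))
  convert this using 1
  ext a
  exact kT_eq w N a.1 a.2

theorem kN_meas {w : ℝ → R} (hw : Continuous w) (n : ℕ) :
    StronglyMeasurable (Function.uncurry (kN w n)) := by
  induction n with
  | zero => exact kG_meas hw
  | succ n ih => exact kT_meas hw ih

theorem kG_supp (w : ℝ → R) {x t : ℝ} (h : x ≤ |t|) : kG w x t = 0 := by
  simp [kG, not_lt.2 h]

theorem kT_supp (w : ℝ → R) {N : ℝ → ℝ → R} (hN : ∀ x t, x ≤ |t| → N x t = 0)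
    {x t : ℝ} (h : x ≤ |t|) : kT w N x t = 0 := by
  unfold kT
  refine setIntegral_eq_zero_of_forall_eq_zero fun s hs => ?_
  rw [hN, mul_zero]
  obtain ⟨h0, h1⟩ := hs
  rcases le_total 0 t with ht | ht
  · rw [abs_of_nonneg ht] at h
    rw [le_abs]; right; linarith
  · rw [abs_of_nonpos ht] at h
    rw [le_abs]; left; linarith

theorem kN_supp (w : ℝ → R) (n : ℕ) : ∀ x t : ℝ, x ≤ |t| → kN w n x t = 0 := by
  induction n with
  | zero => exact fun x t h => kG_supp w h
  | succ n ih => exact fun x t h => kT_supp w ih h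

theorem kS_supp (w : ℝ → R) : ∀ x t : ℝ, x ≤ |t| → kS w x t = 0 := by
  intro x t h
  simp [kS, kN_supp w _ x t h]

theorem kN_bound {w : ℝ → R} {M : ℝ} (hM : 0 < M) (hw : ∀ s, ‖w s‖ ≤ M) (n : ℕ) :
    ∀ x t, ‖kN w n x t‖ ≤ M * (1/2)^n * Real.exp (2*M*x) := by
  induction n with
  | zero =>
    intro x t
    by_cases h : |t| < x
    · simp only [kN, kG, h, if_true]
      have hx : 0 < x := lt_of_le_of_lt (abs_nonneg t) h
      rw [norm_smul]
      have h1 : 1 ≤ Real.exp (2*M*x) := Real.one_le_exp (by positivity)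
      have := hw ((x-t)/2)
      norm_num
      nlinarith [norm_nonneg (w ((x-t)/2))]
    · simp only [kN, kG, h, if_false, norm_zero]; positivity
  | succ n ih =>
    intro x t
    rcases le_or_gt x 0 with hx | hx
    · have : kN w (n+1) x t = 0 := kN_supp w _ x t (hx.trans (abs_nonneg t))
      rw [this, norm_zero]; positivity
    · simp only [kN, kT]
      have hi : IntegrableOn (fun s => M * (M * (1/2)^n * Real.exp (2*M*s))) (Ioo 0 x) :=
        (Continuous.integrableOn_Icc (by fun_prop)).mono_set Ioo_subset_Icc_self
      refine (norm_integral_le_of_norm_le hi ?_).trans ?_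
      · refine Eventually.of_forall fun s => ?_
        refine (norm_mul_le _ _).trans ?_
        exact mul_le_mul (hw s) (ih _ _) (norm_nonneg _) hM.le
      · rw [← integral_Ioc_eq_integral_Ioo, ← intervalIntegral.integral_of_le hx.le]
        have : ∀ s ∈ Set.uIcc 0 x, HasDerivAt (fun s => M * (1/2)^(n+1) * Real.exp (2*M*s))
            (M * (M * (1/2)^n * Real.exp (2*M*s))) s := by
          intro s _
          have h1 : HasDerivAt (fun s : ℝ => 2*M*s) (2*M) s := by
            simpa using (hasDerivAt_id s).const_mul (2*M)
          have := (h1.exp).const_mul (M * (1/2)^(n+1))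
          have e : M * (1/2)^(n+1) * (Real.exp (2*M*s) * (2*M))
              = M * (M * (1/2)^n * Real.exp (2*M*s)) := by
            rw [pow_succ]; ring
          rwa [e] at this
        rw [intervalIntegral.integral_eq_sub_of_hasDerivAt this
          (Continuous.intervalIntegrable (by fun_prop) _ _)]
        have : 0 ≤ M * (1/2)^(n+1) * Real.exp (2*M*0) := by positivity
        linarith

theorem kN_bound' {w : ℝ → R} {M : ℝ} (hM : 0 < M) (hw : ∀ s, ‖w s‖ ≤ M) (n : ℕ)
    {A x : ℝ} (hx : x ≤ A) (t : ℝ) : ‖kN w n x t‖ ≤ (M * Real.exp (2*M*A)) * (1/2)^n := by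
  refine (kN_bound hM hw n x t).trans ?_
  have : Real.exp (2*M*x) ≤ Real.exp (2*M*A) := by
    apply Real.exp_le_exp.2; nlinarith
  have h2 : 0 < M * (1/2:ℝ)^n := by positivity
  nlinarith

theorem kN_bsum (M A : ℝ) : HasSum (fun n : ℕ => (M * Real.exp (2*M*A)) * (1/2:ℝ)^n) ((M * Real.exp (2*M*A)) * 2) := 
  hasSum_geometric_two.mul_left _

theorem kG_cont {w : ℝ → R} (hw : Continuous w) {x t : ℝ} (h : |t| ≠ x) :
    ContinuousAt (Function.uncurry (kG w)) (x, t) := by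
  rcases lt_or_gt_of_ne h with h | h
  · have : ∀ᶠ a : ℝ × ℝ in 𝓝 (x, t), |a.2| < a.1 :=
      (isOpen_lt (by fun_prop) (by fun_prop)).mem_nhds h
    have hc : ContinuousAt (fun a : ℝ × ℝ => (1/2 : ℝ) • w ((a.1 - a.2)/2)) (x,t) := by fun_prop
    refine hc.congr ?_
    filter_upwards [this] with a ha
    simp [Function.uncurry, kG, ha]
  · have : ∀ᶠ a : ℝ × ℝ in 𝓝 (x, t), a.1 < |a.2| :=
      (isOpen_lt (by fun_prop) (by fun_prop)).mem_nhds h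
    refine (continuousAt_const (y := (0:R))).congr ?_
    filter_upwards [this] with a ha
    simp [Function.uncurry, kG, ha.le]

theorem kT_cont {w : ℝ → R} (hw : Continuous w) {M : ℝ} (hM : ∀ s, ‖w s‖ ≤ M)
    {N : ℝ → ℝ → R} (hN : StronglyMeasurable (Function.uncurry N))
    (hb : ∀ A, ∃ C, ∀ x ≤ A, ∀ t, ‖N x t‖ ≤ C)
    (hc : ∀ x t, |t| ≠ x → ContinuousAt (Function.uncurry N) (x, t))
    {x t : ℝ} (h : |t| ≠ x) :
    ContinuousAt (Function.uncurry (kT w N)) (x, t) := by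
  obtain ⟨C, hC⟩ := hb (x+1)
  have hM0 : 0 ≤ M := (norm_nonneg _).trans (hM 0)
  have e : Function.uncurry (kT w N) = fun a : ℝ × ℝ =>
      ∫ s, (Ioo 0 a.1).indicator (fun s => w s * N s (a.1 - s - a.2)) s := by
    ext a; exact kT_eq w N a.1 a.2
  rw [e]
  have hx : ∀ᶠ a : ℝ × ℝ in 𝓝 (x, t), a.1 < x + 1 :=
    (isOpen_lt (by fun_prop) (by fun_prop)).mem_nhds (by simp)
  refine continuousAt_of_dominated (bound := (Ioo 0 (x+1)).indicator (fun _ => M * C)) ?_ ?_ ?_ ?_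
  · refine Eventually.of_forall fun a => ?_
    exact ((kT_int_meas hw hN).comp_measurable (measurable_prodMk_left (x := a))).aestronglyMeasurable
  · filter_upwards [hx] with a ha
    refine Eventually.of_forall fun s => ?_
    by_cases hs : s ∈ Ioo 0 a.1
    · have hs' : s ∈ Ioo 0 (x+1) := ⟨hs.1, hs.2.trans ha⟩
      rw [indicator_of_mem hs, indicator_of_mem hs']
      exact (norm_mul_le _ _).trans
        (mul_le_mul (hM s) (hC _ hs'.2.le _) (norm_nonneg _) hM0)
    · rw [indicator_of_notMem hs, norm_zero]
      have : 0 ≤ C := (norm_nonneg _).trans (hC x (by linarith) 0)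
      exact indicator_nonneg (fun _ _ => by positivity) _
  · exact (integrable_indicator_iff measurableSet_Ioo).2 (integrableOn_const (by simp))
  · by_cases hxt : t = x
    · -- then x < 0
      subst hxt
      have hx0 : t < 0 := by
        by_contra hh; exact h (abs_of_nonneg (not_lt.1 hh))
      have hx' : ∀ᶠ a : ℝ × ℝ in 𝓝 (t, t), a.1 < 0 :=
        (isOpen_lt (by fun_prop) (by fun_prop)).mem_nhds hx0
      refine Eventually.of_forall fun s => ?_
      refine (continuousAt_const (y := (0:R))).congr ?_
      filter_upwards [hx'] with a ha
      rw [Ioo_eq_empty (by linarith)]; simp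
    have hfin : ({x, 0, (x-t)/2} : Set ℝ).Finite := by simp
    filter_upwards [hfin.countable.ae_notMem volume] with s hs
    simp only [mem_insert_iff, mem_singleton_iff, not_or] at hs
    obtain ⟨h1, h0, h2⟩ := hs
    have hN' : ContinuousAt (fun a : ℝ × ℝ => w s * N s (a.1 - s - a.2)) (x,t) := by
      refine continuousAt_const.mul ?_
      have : |x - s - t| ≠ s := by
        intro hh
        rcases abs_choice (x - s - t) with h' | h' <;> rw [h'] at hh
        · exact h2 (by linarith)
        · exact hxt (by linarith)
      exact ContinuousAt.comp (f := fun a : ℝ × ℝ => (s, a.1 - s - a.2)) (g := Function.uncurry N)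
        (x := (x,t)) (hc s _ this) (by fun_prop)
    by_cases hs : 0 < s ∧ s < x
    · refine hN'.congr ?_
      have : ∀ᶠ a : ℝ × ℝ in 𝓝 (x, t), s < a.1 :=
        (isOpen_lt (by fun_prop) (by fun_prop)).mem_nhds hs.2
      filter_upwards [this] with a ha
      rw [indicator_of_mem (show s ∈ Ioo 0 a.1 from ⟨hs.1, ha⟩)]
    · refine (continuousAt_const (y := (0:R))).congr ?_
      by_cases hs0 : 0 < s
      · have : ∀ᶠ a : ℝ × ℝ in 𝓝 (x, t), a.1 < s :=
          (isOpen_lt (by fun_prop) (by fun_prop)).mem_nhds 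
            (lt_of_le_of_ne (not_lt.1 fun hh => hs ⟨hs0, hh⟩) (Ne.symm h1))
        filter_upwards [this] with a ha
        rw [indicator_of_notMem (fun hh => by linarith [hh.2])]
      · refine Eventually.of_forall fun a => ?_
        simp only []
        rw [indicator_of_notMem (fun hh => hs0 hh.1)]

theorem kN_cont {w : ℝ → R} (hw : Continuous w) {M : ℝ} (hM : 0 < M) (hb : ∀ s, ‖w s‖ ≤ M) (n : ℕ) :
    ∀ x t, |t| ≠ x → ContinuousAt (Function.uncurry (kN w n)) (x, t) := by
  induction n with
  | zero => exact fun x t h => kG_cont hw h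
  | succ n ih =>
    refine fun x t h => kT_cont hw hb (kN_meas hw n) ?_ ih h
    exact fun A => ⟨_, fun x hx t => kN_bound' hM hb n hx t⟩

variable [CompleteSpace R]

theorem kN_summable {w : ℝ → R} {M : ℝ} (hM : 0 < M) (hb : ∀ s, ‖w s‖ ≤ M) (x t : ℝ) :
    Summable (fun n => kN w n x t) :=
  Summable.of_norm_bounded (kN_bsum M x).summable (fun n => kN_bound' hM hb n le_rfl t)

theorem kS_bound {w : ℝ → R} {M : ℝ} (hM : 0 < M) (hb : ∀ s, ‖w s‖ ≤ M) 
    {A x : ℝ} (hx : x ≤ A) (t : ℝ) : ‖kS w x t‖ ≤ (M * Real.exp (2*M*A)) * 2 :=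
  tsum_of_norm_bounded (kN_bsum M A) (fun n => kN_bound' hM hb n hx t)

theorem kS_meas {w : ℝ → R} (hw : Continuous w) {M : ℝ} (hM : 0 < M) (hb : ∀ s, ‖w s‖ ≤ M) :
    StronglyMeasurable (Function.uncurry (kS w)) := by
  refine stronglyMeasurable_of_tendsto (u := atTop)
    (f := fun n a => ∑ i ∈ Finset.range n, kN w i a.1 a.2) ?_ ?_
  · intro n
    refine Finset.stronglyMeasurable_fun_sum _ fun i _ => kN_meas hw i
  · rw [tendsto_pi_nhds]
    intro a
    exact (kN_summable hM hb a.1 a.2).hasSum.tendsto_sum_nat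

theorem kS_cont {w : ℝ → R} (hw : Continuous w) {M : ℝ} (hM : 0 < M) (hb : ∀ s, ‖w s‖ ≤ M) 
    {x t : ℝ} (h : |t| ≠ x) : ContinuousAt (Function.uncurry (kS w)) (x, t) := by
  have hU : IsOpen {a : ℝ × ℝ | |a.2| ≠ a.1 ∧ a.1 < x + 1} :=
    (isOpen_ne_fun (by fun_prop) (by fun_prop)).inter (isOpen_lt continuous_fst continuous_const)
  have : ContinuousOn (Function.uncurry (kS w)) {a : ℝ × ℝ | |a.2| ≠ a.1 ∧ a.1 < x + 1} := by
    refine continuousOn_tsum (f := fun n (a : ℝ × ℝ) => kN w n a.1 a.2) ?_ (kN_bsum M (x+1)).summable ?_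
    · exact fun n a ha => (kN_cont hw hM hb n a.1 a.2 ha.1).continuousWithinAt
    · exact fun n a ha => kN_bound' hM hb n ha.2.le _
  exact this.continuousAt (hU.mem_nhds ⟨h, by simp⟩)

theorem kS_eq {w : ℝ → R} (hw : Continuous w) {M : ℝ} (hM : 0 < M) (hb : ∀ s, ‖w s‖ ≤ M)  (x t : ℝ) :
    kS w x t = kG w x t + kT w (kS w) x t := by
  have h1 := (kN_summable hM hb x t).tsum_eq_zero_add
  unfold kS
  rw [h1]
  congr 1
  simp only [kN, kT]
  symm
  have := hasSum_integral_of_dominated_convergence (μ := volume.restrict (Ioo 0 x))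
    (F := fun n s => w s * kN w n s (x - s - t)) (f := fun s => w s * kS w s (x - s - t))
    (bound := fun n _ => M * ((M * Real.exp (2*M*x)) * (1/2:ℝ)^n)) ?_ ?_ ?_ ?_ ?_
  · exact this.tsum_eq.symm
  · intro n
    refine (hw.stronglyMeasurable.mul ?_).aestronglyMeasurable
    exact (kN_meas hw n).comp_measurable (g := fun s : ℝ => (s, x - s - t)) (by fun_prop)
  · intro n
    filter_upwards [ae_restrict_mem measurableSet_Ioo] with s hs
    exact (norm_mul_le _ _).trans (mul_le_mul (hb s) (kN_bound' hM hb n hs.2.le _) (norm_nonneg _) hM.le)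
  · refine Eventually.of_forall fun s => ((kN_bsum M x).mul_left M).summable
  · simp
  · refine Eventually.of_forall fun s => ?_
    exact (kN_summable hM hb s _).hasSum.mul_left _

end gen

section est

theorem jensen_Ioo {q : ℝ} (hq : 1 ≤ q) {x : ℝ} (hx : x ≤ 1) {f : ℝ → ℝ≥0∞} (hf : Measurable f) :
    (∫⁻ s in Ioo 0 x, f s) ^ q ≤ ∫⁻ s in Ioo 0 x, f s ^ q := by
  have h := eLpNorm'_le_eLpNorm'_mul_rpow_measure_univ (μ := volume.restrict (Ioo 0 x)) (p := 1) (q := q)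
    one_pos hq (f := f) hf.aestronglyMeasurable
  simp only [eLpNorm', enorm_eq_self, ENNReal.rpow_one, div_one] at h
  have h1 : (volume.restrict (Ioo 0 x)) univ ≤ 1 := by
    simp; linarith
  have h2 : (volume.restrict (Ioo 0 x)) univ ^ (1 - 1/q) ≤ 1 := by
    refine ENNReal.rpow_le_one h1 ?_
    have : 1/q ≤ 1 := by rw [div_le_one (by linarith)]; exact hq
    linarith
  have h3 : (∫⁻ s in Ioo 0 x, f s) ≤ (∫⁻ s in Ioo 0 x, f s ^ q) ^ (1/q) :=
    h.trans ((mul_le_mul_right h2 _).trans (by rw [mul_one]))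
  calc _ ≤ ((∫⁻ s in Ioo 0 x, f s ^ q) ^ (1/q)) ^ q := ENNReal.rpow_le_rpow h3 (by linarith)
    _ = _ := by rw [← ENNReal.rpow_mul, one_div, inv_mul_cancel₀ (by linarith), ENNReal.rpow_one]

theorem row_swap {ρ : ℝ → ℝ≥0∞} (hρ : Measurable ρ) {F : ℝ → ℝ → ℝ≥0∞}
    (hF : Measurable (Function.uncurry F)) (x : ℝ) :
    ∫⁻ t, ∫⁻ s in Ioo 0 x, ρ s * F s (x - s - t) = ∫⁻ s in Ioo 0 x, ρ s * ∫⁻ t, F s t := by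
  have hm : Measurable (fun a : ℝ × ℝ => ρ a.2 * F a.2 (x - a.2 - a.1)) :=
    (hρ.comp measurable_snd).mul (hF.comp (g := Function.uncurry F) 
      (f := fun a : ℝ × ℝ => (a.2, x - a.2 - a.1)) (by fun_prop))
  rw [lintegral_lintegral_swap hm.aemeasurable]
  refine lintegral_congr fun s => ?_
  have hs : Measurable (F s) := hF.of_uncurry_left
  rw [lintegral_const_mul _ (show Measurable fun t => F s (x - s - t) from hs.comp (by fun_prop))]
  rw [lintegral_sub_left_eq_self (fun t => F s t) (x - s)]

theorem col_swap {ρ : ℝ → ℝ≥0∞} (hρ : Measurable ρ) {F : ℝ → ℝ → ℝ≥0∞}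
    (hF : Measurable (Function.uncurry F)) (t : ℝ) :
    ∫⁻ x in Ioo 0 1, ∫⁻ s in Ioo 0 x, ρ s * F s (x - s - t) ≤ 
      ∫⁻ s in Ioo 0 1, ρ s * ∫⁻ t, F s t := by
  have hm : Measurable (fun a : ℝ × ℝ => ρ a.2 * F a.2 (a.1 - a.2 - t)) :=
    (hρ.comp measurable_snd).mul (hF.comp (g := Function.uncurry F) 
      (f := fun a : ℝ × ℝ => (a.2, a.1 - a.2 - t)) (by fun_prop))
  calc _ ≤ ∫⁻ x in Ioo 0 1, ∫⁻ s in Ioo 0 1, ρ s * F s (x - s - t) := by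
        refine setLIntegral_mono' measurableSet_Ioo fun x hx => ?_
        exact lintegral_mono_set (Ioo_subset_Ioo_right hx.2.le)
    _ ≤ ∫⁻ x, ∫⁻ s in Ioo 0 1, ρ s * F s (x - s - t) := setLIntegral_le_lintegral _ _
    _ = _ := by
      rw [lintegral_lintegral_swap hm.aemeasurable]
      refine lintegral_congr fun s => ?_
      have hs : Measurable (F s) := hF.of_uncurry_left
      rw [lintegral_const_mul _ (show Measurable fun x => F s (x - s - t) from hs.comp (by fun_prop))]
      congr 1
      simp_rw [sub_sub]
      exact lintegral_sub_right_eq_self (fun t => F s t) (s + t)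

theorem lint_half {H : ℝ → ℝ≥0∞} (hH : Measurable H) : ∫⁻ t, H (t/2) = 2 * ∫⁻ t, H t := by
  have h := Real.map_volume_mul_left (a := 1/2) (by norm_num)
  have h2 := lintegral_map (μ := volume) (f := H) hH (g := fun t : ℝ => 1/2 * t) (by fun_prop)
  rw [h] at h2
  simp only [lintegral_smul_measure] at h2
  have : (fun t : ℝ => H (t/2)) = fun t => H (1/2*t) := by
    ext t; congr 1; ring
  rw [this, ← h2]
  norm_num

theorem gron {ψ ρ : ℝ → ℝ≥0∞} {A C B : ℝ≥0∞} {k : ℝ} (hk0 : 0 ≤ k) (hB : B ≠ ∞)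
    (hψ : ∀ x ∈ Icc (0:ℝ) 1, ψ x ≤ B)
    (h : ∀ x ∈ Icc (0:ℝ) 1, ψ x ≤ A + C * ∫⁻ s in Ioo 0 x, ρ s * ψ s)
    (hk : ∀ x ∈ Icc (0:ℝ) 1,
      C * ∫⁻ s in Ioo 0 x, ρ s * ENNReal.ofReal (Real.exp (-(k * (x - s)))) ≤ 1/2) :
    ∀ x ∈ Icc (0:ℝ) 1, ψ x ≤ 2 * A * ENNReal.ofReal (Real.exp k) := by
  set S : ℝ≥0∞ := ⨆ x ∈ Icc (0:ℝ) 1, ψ x * ENNReal.ofReal (Real.exp (-(k * x))) with hS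
  have hle : ∀ x ∈ Icc (0:ℝ) 1, ψ x * ENNReal.ofReal (Real.exp (-(k * x))) ≤ S := fun x hx =>
    le_iSup₂ (f := fun x (_ : x ∈ Icc (0:ℝ) 1) => ψ x * ENNReal.ofReal (Real.exp (-(k * x)))) x hx
  have hmul : ∀ a b : ℝ, ENNReal.ofReal (Real.exp a) * ENNReal.ofReal (Real.exp b)
      = ENNReal.ofReal (Real.exp (a + b)) := by
    intro a b; rw [← ENNReal.ofReal_mul (Real.exp_pos _).le, Real.exp_add]
  have hle' : ∀ x ∈ Icc (0:ℝ) 1, ψ x ≤ S * ENNReal.ofReal (Real.exp (k * x)) := by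
    intro x hx
    have := mul_le_mul_left (hle x hx) (ENNReal.ofReal (Real.exp (k * x)))
    rw [mul_assoc, hmul] at this
    simpa using this
  have hle1 : ∀ x ∈ Icc (0:ℝ) 1, ENNReal.ofReal (Real.exp (-(k * x))) ≤ 1 := by
    intro x hx
    rw [ENNReal.ofReal_le_one]
    exact Real.exp_le_one_iff.2 (by nlinarith [hx.1])
  have hSfin : S ≠ ∞ := by
    refine ne_top_of_le_ne_top hB (iSup₂_le fun x hx => ?_)
    exact (mul_le_mul' (hψ x hx) (hle1 x hx)).trans (by simp)
  have key : S ≤ A + S * (1/2) := by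
    refine iSup₂_le fun x hx => ?_
    have h1 : C * (∫⁻ s in Ioo 0 x, ρ s * ψ s) * ENNReal.ofReal (Real.exp (-(k * x))) ≤ S * (1/2) := by
      calc _ = C * (∫⁻ s in Ioo 0 x, ρ s * ψ s * ENNReal.ofReal (Real.exp (-(k * x)))) := by
            rw [lintegral_mul_const' _ _ ENNReal.ofReal_ne_top, mul_assoc]
        _ ≤ C * (∫⁻ s in Ioo 0 x, S * (ρ s * ENNReal.ofReal (Real.exp (-(k * (x - s)))))) := by
            refine mul_le_mul_right (setLIntegral_mono' measurableSet_Ioo fun s hs => ?_) _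
            have := hle' s ⟨hs.1.le, hs.2.le.trans hx.2⟩
            calc _ ≤ ρ s * (S * ENNReal.ofReal (Real.exp (k * s))) * ENNReal.ofReal (Real.exp (-(k * x))) := by gcongr
              _ = S * (ρ s * (ENNReal.ofReal (Real.exp (k * s)) * ENNReal.ofReal (Real.exp (-(k * x))))) := by ring
              _ = _ := by rw [hmul]; ring_nf
        _ = S * (C * (∫⁻ s in Ioo 0 x, (ρ s * ENNReal.ofReal (Real.exp (-(k * (x - s))))))) := by
            rw [lintegral_const_mul' _ _ hSfin]; ring
        _ ≤ _ := mul_le_mul_right (hk x hx) _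
    calc _ ≤ (A + C * ∫⁻ s in Ioo 0 x, ρ s * ψ s) * ENNReal.ofReal (Real.exp (-(k * x))) := by
          gcongr; exact h x hx
      _ = A * ENNReal.ofReal (Real.exp (-(k * x))) + C * (∫⁻ s in Ioo 0 x, ρ s * ψ s) * ENNReal.ofReal (Real.exp (-(k * x))) := by ring
      _ ≤ A * 1 + S * (1/2) := add_le_add (mul_le_mul_right (hle1 x hx) _) h1
      _ = _ := by rw [mul_one]
  have hS2 : S ≤ 2 * A := by
    have h1 : S * (1/2) + S * (1/2) = S := by
      rw [← mul_add, one_div, ENNReal.inv_two_add_inv_two, mul_one]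
    have hf : S * (1/2) ≠ ∞ := ENNReal.mul_ne_top hSfin (by simp)
    have h2 : S * (1/2) ≤ A := by
      have : S * (1/2) + S * (1/2) ≤ A + S * (1/2) := by rw [h1]; exact key
      exact (ENNReal.add_le_add_iff_right hf).1 this
    calc S = S * (1/2) + S * (1/2) := h1.symm
      _ ≤ A + A := add_le_add h2 h2
      _ = 2 * A := by ring
  intro x hx
  refine (hle' x hx).trans (mul_le_mul' hS2 (ENNReal.ofReal_le_ofReal (Real.exp_le_exp.2 ?_)))
  nlinarith [hx.2]

theorem exp_int {k : ℝ} (hk : 0 < k) {x : ℝ} (hx : 0 ≤ x) :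
    ∫⁻ s in Ioo 0 x, ENNReal.ofReal (Real.exp (-(k * (x - s)))) ≤ ENNReal.ofReal (1/k) := by
  have hi : IntegrableOn (fun s => Real.exp (-(k * (x - s)))) (Ioo 0 x) :=
    (Continuous.integrableOn_Icc (by fun_prop)).mono_set Ioo_subset_Icc_self
  rw [← ofReal_integral_eq_lintegral_ofReal hi (Eventually.of_forall fun s => (Real.exp_pos _).le)]
  refine ENNReal.ofReal_le_ofReal ?_
  rw [← integral_Ioc_eq_integral_Ioo, ← intervalIntegral.integral_of_le hx]
  have : ∀ s ∈ Set.uIcc 0 x, HasDerivAt (fun s => 1/k * Real.exp (-(k * (x - s))))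
      (Real.exp (-(k * (x - s)))) s := by
    intro s _
    have h1 : HasDerivAt (fun s : ℝ => -(k * (x - s))) k s := by
      have := (((hasDerivAt_id s).const_sub x).const_mul k).neg
      have e : -(k * -1) = k := by ring
      rw [e] at this
      exact this
    have := (h1.exp).const_mul (1/k)
    have e : 1/k * (Real.exp (-(k * (x - s))) * k) = Real.exp (-(k * (x - s))) := by
      field_simp
    rwa [e] at this
  rw [intervalIntegral.integral_eq_sub_of_hasDerivAt this
    (Continuous.intervalIntegrable (by fun_prop) _ _)]
  have : 0 ≤ 1/k * Real.exp (-(k * (x - 0))) := by positivity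
  simp only [sub_self, mul_zero, neg_zero, Real.exp_zero]
  linarith

end est

section est2
set_option linter.unusedSectionVars false
variable {R : Type*} [NormedRing R] [NormedAlgebra ℝ R]

def BC (w : ℝ → R) : Prop := Continuous w ∧ ∃ M : ℝ, 0 < M ∧ ∀ s, ‖w s‖ ≤ M

def rwn (q : ℝ) (F : ℝ → ℝ → R) (x : ℝ) : ℝ≥0∞ := ∫⁻ t, ‖F x t‖ₑ ^ q
def cln (q : ℝ) (F : ℝ → ℝ → R) (t : ℝ) : ℝ≥0∞ := ∫⁻ x in Ioo 0 1, ‖F x t‖ₑ ^ q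
def nq (q : ℝ) (d : ℝ → R) : ℝ≥0∞ := ∫⁻ s in Ioo 0 1, ‖d s‖ₑ ^ q

theorem enorm_q_meas {α : Type*} [MeasurableSpace α] {f : α → R} (hf : StronglyMeasurable f) (q : ℝ) :
    Measurable fun a => ‖f a‖ₑ ^ q := hf.enorm.pow_const q

theorem enorm_ring_mul_le (a b : R) : ‖a * b‖ₑ ≤ ‖a‖ₑ * ‖b‖ₑ := by
  rw [← ofReal_norm, ← ofReal_norm, ← ofReal_norm, ← ENNReal.ofReal_mul (norm_nonneg _)]
  exact ENNReal.ofReal_le_ofReal (norm_mul_le a b)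

theorem kG_pt {q : ℝ} (hq : 1 ≤ q) (d : ℝ → R) {x : ℝ} (hx : x ≤ 1) (t : ℝ) :
    ‖kG d x t‖ₑ ^ q ≤ (Ioo (0:ℝ) 1).indicator (fun s => ‖d s‖ₑ ^ q) ((x - t)/2) := by
  unfold kG
  split_ifs with h
  · have h' := abs_lt.1 h
    rw [indicator_of_mem (show (x-t)/2 ∈ Ioo (0:ℝ) 1 from ⟨by linarith, by linarith⟩)]
    refine ENNReal.rpow_le_rpow ?_ (by linarith)
    rw [← ofReal_norm, ← ofReal_norm]
    refine ENNReal.ofReal_le_ofReal ?_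
    rw [norm_smul]
    norm_num
    linarith [norm_nonneg (d ((x-t)/2))]
  · rw [enorm_zero, ENNReal.zero_rpow_of_pos (by linarith)]; exact zero_le

theorem nq_ind {q : ℝ} {d : ℝ → R} :
    ∫⁻ s, (Ioo (0:ℝ) 1).indicator (fun s => ‖d s‖ₑ ^ q) s = nq q d := by
  rw [lintegral_indicator measurableSet_Ioo]; rfl

theorem kG_row {q : ℝ} (hq : 1 ≤ q) {d : ℝ → R} (hd : Continuous d) {x : ℝ} (hx : x ≤ 1) :
    rwn q (kG d) x ≤ 2 * nq q d := by
  have hm : Measurable ((Ioo (0:ℝ) 1).indicator (fun s => ‖d s‖ₑ ^ q)) :=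
    (enorm_q_meas hd.stronglyMeasurable q).indicator measurableSet_Ioo
  calc _ ≤ ∫⁻ t, (Ioo (0:ℝ) 1).indicator (fun s => ‖d s‖ₑ ^ q) ((x - t)/2) :=
        lintegral_mono fun t => kG_pt hq d hx t
    _ = ∫⁻ t, (Ioo (0:ℝ) 1).indicator (fun s => ‖d s‖ₑ ^ q) (t/2) :=
        lintegral_sub_left_eq_self (fun t => (Ioo (0:ℝ) 1).indicator (fun s => ‖d s‖ₑ ^ q) (t/2)) x
    _ = _ := by rw [lint_half hm, nq_ind]

theorem kG_col {q : ℝ} (hq : 1 ≤ q) {d : ℝ → R} (hd : Continuous d) (t : ℝ) :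
    cln q (kG d) t ≤ 2 * nq q d := by
  have hm : Measurable ((Ioo (0:ℝ) 1).indicator (fun s => ‖d s‖ₑ ^ q)) :=
    (enorm_q_meas hd.stronglyMeasurable q).indicator measurableSet_Ioo
  calc _ ≤ ∫⁻ x in Ioo 0 1, (Ioo (0:ℝ) 1).indicator (fun s => ‖d s‖ₑ ^ q) ((x - t)/2) :=
        setLIntegral_mono' measurableSet_Ioo fun x hx => kG_pt hq d hx.2.le t
    _ ≤ ∫⁻ x, (Ioo (0:ℝ) 1).indicator (fun s => ‖d s‖ₑ ^ q) ((x - t)/2) :=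
        setLIntegral_le_lintegral _ _
    _ = ∫⁻ t, (Ioo (0:ℝ) 1).indicator (fun s => ‖d s‖ₑ ^ q) (t/2) :=
        lintegral_sub_right_eq_self (fun t => (Ioo (0:ℝ) 1).indicator (fun s => ‖d s‖ₑ ^ q) (t/2)) t
    _ = _ := by rw [lint_half hm, nq_ind]

theorem kT_pt {q : ℝ} (hq : 1 ≤ q) {d : ℝ → R} (hd : Continuous d) {F : ℝ → ℝ → R}
    (hF : StronglyMeasurable (Function.uncurry F)) {x : ℝ} (hx : x ≤ 1) (t : ℝ) :
    ‖kT d F x t‖ₑ ^ q ≤ ∫⁻ s in Ioo 0 x, ‖d s‖ₑ ^ q * ‖F s (x - s - t)‖ₑ ^ q := by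
  have hFm : StronglyMeasurable fun s => F s (x - s - t) :=
    hF.comp_measurable (g := fun s : ℝ => (s, x - s - t)) (by fun_prop)
  have hm : Measurable fun s => ‖d s‖ₑ * ‖F s (x - s - t)‖ₑ := by
    exact (hd.stronglyMeasurable.enorm).mul hFm.enorm
  calc _ ≤ (∫⁻ s in Ioo 0 x, ‖d s‖ₑ * ‖F s (x - s - t)‖ₑ) ^ q := by
        refine ENNReal.rpow_le_rpow ((enorm_integral_le_lintegral_enorm _).trans ?_) (by linarith)
        exact lintegral_mono fun s => enorm_ring_mul_le _ _
    _ ≤ _ := by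
        refine (jensen_Ioo hq hx hm).trans_eq ?_
        refine lintegral_congr fun s => ?_
        rw [ENNReal.mul_rpow_of_nonneg _ _ (by linarith)]

theorem kT_row {q : ℝ} (hq : 1 ≤ q) {d : ℝ → R} (hd : Continuous d) {F : ℝ → ℝ → R}
    (hF : StronglyMeasurable (Function.uncurry F)) {x : ℝ} (hx : x ≤ 1) :
    rwn q (kT d F) x ≤ ∫⁻ s in Ioo 0 x, ‖d s‖ₑ ^ q * rwn q F s := by
  refine (lintegral_mono fun t => kT_pt hq hd hF hx t).trans_eq ?_
  exact row_swap (enorm_q_meas hd.stronglyMeasurable q) (F := fun s t => ‖F s t‖ₑ ^ q)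
    (enorm_q_meas hF q) x

theorem kT_col {q : ℝ} (hq : 1 ≤ q) {d : ℝ → R} (hd : Continuous d) {F : ℝ → ℝ → R}
    (hF : StronglyMeasurable (Function.uncurry F)) (t : ℝ) :
    cln q (kT d F) t ≤ ∫⁻ s in Ioo 0 1, ‖d s‖ₑ ^ q * rwn q F s := by
  refine (setLIntegral_mono' measurableSet_Ioo fun x hx => kT_pt hq hd hF hx.2.le t).trans ?_
  exact col_swap (enorm_q_meas hd.stronglyMeasurable q) (F := fun s t => ‖F s t‖ₑ ^ q)
    (enorm_q_meas hF q) t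

def c1 (q : ℝ) : ℝ≥0∞ := 2 ^ (q - 1)
def Cq (q : ℝ) : ℝ≥0∞ := c1 q * c1 q

theorem c1_ge {q : ℝ} (hq : 1 ≤ q) : 1 ≤ c1 q := by
  have := ENNReal.rpow_le_rpow_of_exponent_le (x := 2) (by norm_num) (show (0:ℝ) ≤ q - 1 by linarith)
  simpa [c1] using this
theorem c1_fin (q : ℝ) : c1 q ≠ ∞ := by simp [c1]
theorem Cq_fin (q : ℝ) : Cq q ≠ ∞ := ENNReal.mul_ne_top (c1_fin q) (c1_fin q)

theorem add2_q {q : ℝ} (hq : 1 ≤ q) (a b : R) : ‖a + b‖ₑ ^ q ≤ c1 q * (‖a‖ₑ ^ q + ‖b‖ₑ ^ q) :=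
  (ENNReal.rpow_le_rpow (enorm_add_le a b) (by linarith)).trans
    (ENNReal.rpow_add_le_mul_rpow_add_rpow _ _ hq)

theorem add3_q {q : ℝ} (hq : 1 ≤ q) (a b c : R) :
    ‖a + b + c‖ₑ ^ q ≤ Cq q * (‖a‖ₑ ^ q + ‖b‖ₑ ^ q + ‖c‖ₑ ^ q) := by
  refine (add2_q hq (a+b) c).trans ?_
  unfold Cq
  rw [mul_assoc]
  gcongr
  rw [mul_add]
  refine add_le_add (add2_q hq a b) ?_
  exact le_mul_of_one_le_left' (c1_ge hq)

theorem nq_tri {q : ℝ} (hq : 1 ≤ q) {a : ℝ → R} (ha : Continuous a) (b : ℝ → R)  :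
    nq q (fun s => a s + b s) ≤ c1 q * (nq q a + nq q b) := by
  unfold nq
  rw [← lintegral_add_left (enorm_q_meas ha.stronglyMeasurable q), ← lintegral_const_mul' _ _ (c1_fin q)]
  exact lintegral_mono fun s => add2_q hq _ _

theorem nq_bdd {q : ℝ} (hq : 1 ≤ q) {a : ℝ → R} {M : ℝ} (ha : ∀ s, ‖a s‖ ≤ M) :
    nq q a ≤ ENNReal.ofReal M ^ q := by
  unfold nq
  calc _ ≤ ∫⁻ s in Ioo (0:ℝ) 1, ENNReal.ofReal M ^ q := by
        refine lintegral_mono fun s => ENNReal.rpow_le_rpow ?_ (by linarith)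
        rw [← ofReal_norm]; exact ENNReal.ofReal_le_ofReal (ha s)
    _ = _ := by simp

theorem modulus {q : ℝ} (hq : 1 ≤ q) {C : ℝ≥0∞} (hC : C ≠ ∞) :
    ∃ η : ℝ≥0∞, η ≠ 0 ∧ η ≠ ∞ ∧ ∀ M : ℝ, ∃ k : ℝ, 0 ≤ k ∧ ∀ h h0 : ℝ → R, Continuous h → Continuous h0 →
      (∀ s, ‖h0 s‖ ≤ M) → nq q (fun s => h s - h0 s) ≤ η →
      ∀ x ∈ Icc (0:ℝ) 1, C * ∫⁻ s in Ioo 0 x, ‖h s‖ₑ ^ q *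
        ENNReal.ofReal (Real.exp (-(k * (x - s)))) ≤ 1/2 := by
  set D := C * c1 q + 1 with hD
  have hDf : D ≠ ∞ := by simp [hD, ENNReal.mul_ne_top hC (c1_fin q)]
  have hD0 : D ≠ 0 := by simp [hD]
  refine ⟨4⁻¹ / D, ?_, ?_, ?_⟩
  · simp [ENNReal.div_eq_zero_iff, hDf]
  · exact ENNReal.div_ne_top (by simp) hD0
  intro M
  set E := D * ENNReal.ofReal M ^ q with hE
  have hEf : E ≠ ∞ := ENNReal.mul_ne_top hDf (ENNReal.rpow_ne_top_of_nonneg (by linarith) (by simp))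
  refine ⟨4 * E.toReal + 1, by positivity, ?_⟩
  set k := 4 * E.toReal + 1 with hk
  have hk0 : 0 < k := by positivity
  intro h h0 hh hh0 hb hη x hx
  have hexp1 : ∀ s ∈ Ioo 0 x, ENNReal.ofReal (Real.exp (-(k * (x - s)))) ≤ 1 := by
    intro s hs
    rw [ENNReal.ofReal_le_one]
    exact Real.exp_le_one_iff.2 (by nlinarith [hs.2])
  have hmeas : Measurable fun s => ‖h s - h0 s‖ₑ ^ q :=
    enorm_q_meas (hh.sub hh0).stronglyMeasurable q
  have h1 : ∫⁻ s in Ioo 0 x, ‖h s‖ₑ ^ q * ENNReal.ofReal (Real.exp (-(k * (x - s)))) ≤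
      c1 q * (4⁻¹ / D + ENNReal.ofReal M ^ q * ENNReal.ofReal (1/k)) := by
    calc _ ≤ ∫⁻ s in Ioo 0 x, c1 q * (‖h s - h0 s‖ₑ ^ q + 
              ENNReal.ofReal M ^ q * ENNReal.ofReal (Real.exp (-(k * (x - s))))) := by
          refine setLIntegral_mono' measurableSet_Ioo fun s hs => ?_
          have e := add2_q hq (h s - h0 s) (h0 s)
          rw [sub_add_cancel] at e
          have e2 : ‖h0 s‖ₑ ^ q ≤ ENNReal.ofReal M ^ q := by
            refine ENNReal.rpow_le_rpow ?_ (by linarith)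
            rw [← ofReal_norm]; exact ENNReal.ofReal_le_ofReal (hb s)
          calc _ ≤ c1 q * (‖h s - h0 s‖ₑ ^ q + ENNReal.ofReal M ^ q) * ENNReal.ofReal (Real.exp (-(k * (x - s)))) := by
                gcongr
                exact e.trans (by gcongr)
            _ = c1 q * (‖h s - h0 s‖ₑ ^ q * ENNReal.ofReal (Real.exp (-(k * (x - s)))) + 
              ENNReal.ofReal M ^ q * ENNReal.ofReal (Real.exp (-(k * (x - s))))) := by ring
            _ ≤ _ := by
                gcongr
                exact mul_le_of_le_one_right' (hexp1 s hs)
      _ = c1 q * ((∫⁻ s in Ioo 0 x, ‖h s - h0 s‖ₑ ^ q) + 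
              ENNReal.ofReal M ^ q * ∫⁻ s in Ioo 0 x, ENNReal.ofReal (Real.exp (-(k * (x - s))))) := by
          rw [lintegral_const_mul' _ _ (c1_fin q), lintegral_add_left hmeas,
            lintegral_const_mul' _ _ (ENNReal.rpow_ne_top_of_nonneg (by linarith) (by simp))]
      _ ≤ _ := by
          gcongr
          · exact (lintegral_mono_set (Ioo_subset_Ioo_right hx.2)).trans hη
          · exact exp_int hk0 hx.1
  calc _ ≤ C * (c1 q * (4⁻¹ / D + ENNReal.ofReal M ^ q * ENNReal.ofReal (1/k))) := by gcongr
    _ = (C * c1 q) * (4⁻¹ / D) + (C * c1 q) * ENNReal.ofReal M ^ q * ENNReal.ofReal (1/k) := by ring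
    _ ≤ D * (4⁻¹ / D) + E * ENNReal.ofReal (1/k) := by
        rw [hE]
        gcongr <;> exact le_self_add
    _ ≤ 4⁻¹ + 4⁻¹ := by
        refine add_le_add ENNReal.mul_div_le ?_
        rw [← ENNReal.ofReal_toReal hEf, ← ENNReal.ofReal_mul ENNReal.toReal_nonneg]
        have : (4:ℝ≥0∞)⁻¹ = ENNReal.ofReal (1/4) := by
          rw [one_div, ENNReal.ofReal_inv_of_pos (by norm_num)]; norm_num
        rw [this]
        refine ENNReal.ofReal_le_ofReal ?_
        rw [mul_one_div, div_le_div_iff₀ hk0 (by norm_num)]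
        linarith
    _ = 1/2 := by
        have : (4:ℝ≥0∞)⁻¹ = ENNReal.ofReal (1/4) := by
          rw [one_div, ENNReal.ofReal_inv_of_pos (by norm_num)]; norm_num
        rw [this, ← ENNReal.ofReal_add (by norm_num) (by norm_num)]
        have : (1/2:ℝ≥0∞) = ENNReal.ofReal (1/2) := by
          rw [one_div, one_div, ENNReal.ofReal_inv_of_pos (by norm_num)]; norm_num
        rw [this]; norm_num

end est2

section stab
set_option linter.unusedSectionVars false
variable {R : Type*} [NormedRing R] [NormedAlgebra ℝ R] [CompleteSpace R]

theorem kS_zero (x t : ℝ) : kS (fun _ => (0:R)) x t = 0 := by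
  have : ∀ n x t, kN (fun _ => (0:R)) n x t = 0 := by
    intro n x t
    cases n with
    | zero => simp [kN, kG]
    | succ n => simp [kN, kT]
  simp [kS, this]

theorem BC.meas {w : ℝ → R} (hw : BC w) : StronglyMeasurable (Function.uncurry (kS w)) := by
  obtain ⟨hc, M, hM, hb⟩ := hw
  exact kS_meas hc hM hb

theorem BC.bound {w : ℝ → R} (hw : BC w) (A : ℝ) : ∃ C : ℝ, ∀ x ≤ A, ∀ t, ‖kS w x t‖ ≤ C := by
  obtain ⟨hc, M, hM, hb⟩ := hw
  exact ⟨_, fun x hx t => kS_bound hM hb hx t⟩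

theorem BC.eq {w : ℝ → R} (hw : BC w) (x t : ℝ) : kS w x t = kG w x t + kT w (kS w) x t := by
  obtain ⟨hc, M, hM, hb⟩ := hw
  exact kS_eq hc hM hb x t

theorem BC.contAt {w : ℝ → R} (hw : BC w) {x t : ℝ} (h : |t| ≠ x) :
    ContinuousAt (Function.uncurry (kS w)) (x, t) := by
  obtain ⟨hc, M, hM, hb⟩ := hw
  exact kS_cont hc hM hb h

theorem kT_integrable {d : ℝ → R} (hd : BC d) {F : ℝ → ℝ → R}
    (hF : StronglyMeasurable (Function.uncurry F)) (hb : ∀ A : ℝ, ∃ C : ℝ, ∀ x ≤ A, ∀ t, ‖F x t‖ ≤ C)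
    (x t : ℝ) : IntegrableOn (fun s => d s * F s (x - s - t)) (Ioo 0 x) := by
  obtain ⟨hc, M, hM, hdb⟩ := hd
  obtain ⟨C, hC⟩ := hb x
  have hFm : StronglyMeasurable fun s => F s (x - s - t) :=
    hF.comp_measurable (g := fun s : ℝ => (s, x - s - t)) (by fun_prop)
  refine Measure.integrableOn_of_bounded (M := M * C) (by simp)
    ((hc.stronglyMeasurable.mul hFm).aestronglyMeasurable) ?_
  filter_upwards [ae_restrict_mem measurableSet_Ioo] with s hs
  exact (norm_mul_le _ _).trans (mul_le_mul (hdb s) (hC s hs.2.le _) (norm_nonneg _) hM.le)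

theorem BC.sub {w w' : ℝ → R} (hw : BC w) (hw' : BC w') : BC (fun s => w s - w' s) := by
  obtain ⟨hc, M, hM, hb⟩ := hw
  obtain ⟨hc', M', hM', hb'⟩ := hw'
  exact ⟨hc.sub hc', M + M', by positivity, fun s => (norm_sub_le _ _).trans (add_le_add (hb s) (hb' s))⟩

theorem diff_eq {w w' : ℝ → R} (hw : BC w) (hw' : BC w') (x t : ℝ) :
    kS w x t - kS w' x t = kG (fun s => w s - w' s) x t + kT (fun s => w s - w' s) (kS w) x t
      + kT w' (fun x t => kS w x t - kS w' x t) x t := by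
  have i1 := kT_integrable hw hw.meas hw.bound x t
  have i2 := kT_integrable hw' hw'.meas hw'.bound x t
  have i3 := kT_integrable hw' hw.meas hw.bound x t
  have e1 : kT (fun s => w s - w' s) (kS w) x t = kT w (kS w) x t - kT w' (kS w) x t := by
    unfold kT
    rw [← integral_sub i1 i3]
    simp_rw [sub_mul]
  have e2 : kT w' (fun x t => kS w x t - kS w' x t) x t = kT w' (kS w) x t - kT w' (kS w') x t := by
    unfold kT
    rw [← integral_sub i3 i2]
    simp_rw [mul_sub]
  have e3 : kG (fun s => w s - w' s) x t = kG w x t - kG w' x t := by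
    unfold kG; split_ifs <;> simp [smul_sub]
  rw [e1, e2, e3, hw.eq x t, hw'.eq x t]
  abel

theorem BC.dmeas {w w' : ℝ → R} (hw : BC w) (hw' : BC w') :
    StronglyMeasurable (Function.uncurry fun x t => kS w x t - kS w' x t) := hw.meas.sub hw'.meas

theorem row_meas {q : ℝ} {F : ℝ → ℝ → R} (hF : StronglyMeasurable (Function.uncurry F)) (x : ℝ) :
    Measurable fun t => ‖F x t‖ₑ ^ q :=
  enorm_q_meas (hF.comp_measurable (g := fun t : ℝ => (x, t)) (by fun_prop)) q
theorem col_meas {q : ℝ} {F : ℝ → ℝ → R} (hF : StronglyMeasurable (Function.uncurry F)) (t : ℝ) :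
    Measurable fun x => ‖F x t‖ₑ ^ q :=
  enorm_q_meas (hF.comp_measurable (g := fun x : ℝ => (x, t)) (by fun_prop)) q

theorem add3_lint {q : ℝ} (hq : 1 ≤ q) {μ : Measure ℝ} {f a b c : ℝ → R} (h : ∀ s, f s = a s + b s + c s)
    (ha : Measurable fun s => ‖a s‖ₑ ^ q) (hb : Measurable fun s => ‖b s‖ₑ ^ q) :
    ∫⁻ s, ‖f s‖ₑ ^ q ∂μ ≤ Cq q * (∫⁻ s, ‖a s‖ₑ ^ q ∂μ + ∫⁻ s, ‖b s‖ₑ ^ q ∂μ + ∫⁻ s, ‖c s‖ₑ ^ q ∂μ) := by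
  rw [← lintegral_add_left ha, ← lintegral_add_left (show Measurable fun s => ‖a s‖ₑ ^ q + ‖b s‖ₑ ^ q from ha.add hb), ← lintegral_const_mul' _ _ (Cq_fin q)]
  refine lintegral_mono fun s => ?_
  rw [h s]
  exact add3_q hq _ _ _

theorem diff_row {q : ℝ} (hq : 1 ≤ q) {w w' : ℝ → R} (hw : BC w) (hw' : BC w') {x : ℝ} (hx : x ≤ 1) :
    rwn q (fun x t => kS w x t - kS w' x t) x ≤ Cq q * (2 * nq q (fun s => w s - w' s) +
      (∫⁻ s in Ioo 0 x, ‖w s - w' s‖ₑ ^ q * rwn q (kS w) s) +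
      ∫⁻ s in Ioo 0 x, ‖w' s‖ₑ ^ q * rwn q (fun x t => kS w x t - kS w' x t) s) := by
  have hd := (hw.sub hw').1
  refine (add3_lint hq (fun t => diff_eq hw hw' x t) (row_meas (kG_meas hd) x)
    (row_meas (kT_meas hd hw.meas) x)).trans ?_
  refine mul_le_mul_right (add_le_add (add_le_add ?_ ?_) ?_) _
  · exact kG_row hq hd hx
  · exact kT_row hq hd hw.meas hx
  · exact kT_row hq hw'.1 (hw.dmeas hw') hx

theorem diff_col {q : ℝ} (hq : 1 ≤ q) {w w' : ℝ → R} (hw : BC w) (hw' : BC w') (t : ℝ) :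
    cln q (fun x t => kS w x t - kS w' x t) t ≤ Cq q * (2 * nq q (fun s => w s - w' s) +
      (∫⁻ s in Ioo 0 1, ‖w s - w' s‖ₑ ^ q * rwn q (kS w) s) +
      ∫⁻ s in Ioo 0 1, ‖w' s‖ₑ ^ q * rwn q (fun x t => kS w x t - kS w' x t) s) := by
  have hd := (hw.sub hw').1
  refine (add3_lint hq (fun x => diff_eq hw hw' x t) (col_meas (kG_meas hd) t)
    (col_meas (kT_meas hd hw.meas) t)).trans ?_
  refine mul_le_mul_right (add_le_add (add_le_add ?_ ?_) ?_) _
  · exact kG_col hq hd t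
  · exact kT_col hq hd hw.meas t
  · exact kT_col hq hw'.1 (hw.dmeas hw') t

theorem rwn_fin {q : ℝ} (hq : 1 ≤ q) {F : ℝ → ℝ → R} (hs : ∀ x t, x ≤ |t| → F x t = 0)
    (hb : ∀ A : ℝ, ∃ C : ℝ, ∀ x ≤ A, ∀ t, ‖F x t‖ ≤ C) :
    ∃ B : ℝ≥0∞, B ≠ ∞ ∧ ∀ x ∈ Icc (0:ℝ) 1, rwn q F x ≤ B := by
  obtain ⟨C, hC⟩ := hb 1
  refine ⟨∫⁻ t, (Ioo (-1:ℝ) 1).indicator (fun _ => ENNReal.ofReal C ^ q) t, ?_, fun x hx => ?_⟩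
  · rw [lintegral_indicator measurableSet_Ioo]
    simp only [lintegral_const, Measure.restrict_apply_univ, Real.volume_Ioo]
    exact ENNReal.mul_ne_top (ENNReal.rpow_ne_top_of_nonneg (by linarith) (by simp)) (by simp)
  · refine lintegral_mono fun t => ?_
    by_cases ht : t ∈ Ioo (-1:ℝ) 1
    · rw [indicator_of_mem ht]
      refine ENNReal.rpow_le_rpow ?_ (by linarith)
      rw [← ofReal_norm]; exact ENNReal.ofReal_le_ofReal (hC x hx.2 t)
    · rw [indicator_of_notMem ht, hs x t, enorm_zero, ENNReal.zero_rpow_of_pos (by linarith)]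
      by_contra hh
      have := abs_lt.1 (not_le.1 hh)
      exact ht ⟨by linarith [hx.2], by linarith [hx.2]⟩

theorem stab {q : ℝ} (hq : 1 ≤ q) :
    ∃ η : ℝ≥0∞, η ≠ 0 ∧ η ≠ ∞ ∧ ∀ h0 : ℝ → R, BC h0 → ∃ L : ℝ≥0∞, L ≠ ∞ ∧
      ∀ w w' : ℝ → R, BC w → BC w' → nq q (fun s => w s - h0 s) ≤ η → nq q (fun s => w' s - h0 s) ≤ η →
        (∀ x ∈ Icc (0:ℝ) 1, rwn q (fun x t => kS w x t - kS w' x t) x ≤ L * nq q (fun s => w s - w' s)) ∧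
        (∀ t, cln q (fun x t => kS w x t - kS w' x t) t ≤ L * nq q (fun s => w s - w' s)) := by
  obtain ⟨η, h0, htop, H⟩ := modulus (R := R) hq (Cq_fin q)
  refine ⟨η, h0, htop, fun h0 hh0 => ?_⟩
  have hh0' := hh0
  obtain ⟨hc0, M, hM, hM0⟩ := hh0
  obtain ⟨k, hk0, hk⟩ := H M
  set Bn := c1 q * (η + ENNReal.ofReal M ^ q) with hBn
  have hBnf : Bn ≠ ∞ := ENNReal.mul_ne_top (c1_fin q)
    (ENNReal.add_ne_top.2 ⟨htop, ENNReal.rpow_ne_top_of_nonneg (by linarith) (by simp)⟩)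
  set e := ENNReal.ofReal (Real.exp k) with he
  have hef : e ≠ ∞ := ENNReal.ofReal_ne_top
  set Φ := 2 * (Cq q * (2 * Bn)) * e with hΦ
  have hCf := Cq_fin q
  have hΦf : Φ ≠ ∞ := by
    refine ENNReal.mul_ne_top (ENNReal.mul_ne_top (by simp) (ENNReal.mul_ne_top hCf (ENNReal.mul_ne_top (by simp) hBnf))) hef
  set P := 2 * (Cq q * (2 + Φ)) * e with hP
  have hPf : P ≠ ∞ := by
    refine ENNReal.mul_ne_top (ENNReal.mul_ne_top (by simp) (ENNReal.mul_ne_top hCf (ENNReal.add_ne_top.2 ⟨by simp, hΦf⟩))) hef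
  have hnq : ∀ w : ℝ → R, BC w → nq q (fun s => w s - h0 s) ≤ η → nq q w ≤ Bn := by
    intro w hw hη
    have := nq_tri hq (hw.sub hh0').1 h0
    simp only [sub_add_cancel] at this
    exact this.trans (mul_le_mul_right (add_le_add hη (nq_bdd hq hM0)) _)
  have hap : ∀ w : ℝ → R, BC w → nq q (fun s => w s - h0 s) ≤ η → ∀ x ∈ Icc (0:ℝ) 1, rwn q (kS w) x ≤ Φ := by
    intro w hw hη x hx
    have hz : BC (fun _ : ℝ => (0:R)) := ⟨continuous_const, 1, one_pos, by simp⟩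
    obtain ⟨B, hB, hBb⟩ := rwn_fin hq (kS_supp w) hw.bound
    have key : ∀ x ∈ Icc (0:ℝ) 1, rwn q (kS w) x ≤
        Cq q * (2 * nq q w) + Cq q * ∫⁻ s in Ioo 0 x, ‖w s‖ₑ ^ q * rwn q (kS w) s := by
      intro x hx
      have := diff_row hq hz hw hx.2
      have e0 : ∀ s, rwn q (kS (fun _ => (0:R))) s = 0 := by
        intro s; simp [rwn, kS_zero, ENNReal.zero_rpow_of_pos (show 0 < q by linarith)]
      have e1 : ∀ s, rwn q (fun x t => kS (fun _ => (0:R)) x t - kS w x t) s = rwn q (kS w) s := by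
        intro s; simp [rwn, kS_zero]
      have e2 : nq q (fun s => (0:R) - w s) = nq q w := by simp [nq]
      rw [e1, e2] at this
      simp only [e0, e1, mul_zero, lintegral_zero, add_zero] at this
      rwa [mul_add] at this
    have := gron hk0 hB hBb key (fun x hx => hk w h0 hw.1 hc0 hM0 hη x hx) x hx
    refine this.trans ?_
    rw [hΦ]
    gcongr
    exact hnq w hw hη
  refine ⟨P + Cq q * (2 + Φ + Bn * P), ?_, ?_⟩
  · exact ENNReal.add_ne_top.2 ⟨hPf, ENNReal.mul_ne_top hCf (ENNReal.add_ne_top.2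
      ⟨ENNReal.add_ne_top.2 ⟨by simp, hΦf⟩, ENNReal.mul_ne_top hBnf hPf⟩)⟩
  intro w w' hw hw' hη hη'
  set n := nq q (fun s => w s - w' s) with hn
  have hmid : ∀ x ∈ Icc (0:ℝ) 1, ∫⁻ s in Ioo 0 x, ‖w s - w' s‖ₑ ^ q * rwn q (kS w) s ≤ n * Φ := by
    intro x hx
    calc _ ≤ ∫⁻ s in Ioo 0 x, ‖w s - w' s‖ₑ ^ q * Φ := by
          refine setLIntegral_mono' measurableSet_Ioo fun s hs => ?_
          gcongr
          exact hap w hw hη s ⟨hs.1.le, hs.2.le.trans hx.2⟩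
      _ = (∫⁻ s in Ioo 0 x, ‖w s - w' s‖ₑ ^ q) * Φ := lintegral_mul_const' _ _ hΦf
      _ ≤ _ := by
          gcongr
          exact lintegral_mono_set (Ioo_subset_Ioo_right hx.2)
  have hrow : ∀ x ∈ Icc (0:ℝ) 1, rwn q (fun x t => kS w x t - kS w' x t) x ≤ P * n := by
    have hsupp : ∀ x t, x ≤ |t| → kS w x t - kS w' x t = 0 := by
      intro x t h; rw [kS_supp w x t h, kS_supp w' x t h, sub_zero]
    have hbd : ∀ A : ℝ, ∃ C : ℝ, ∀ x ≤ A, ∀ t, ‖kS w x t - kS w' x t‖ ≤ C := by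
      intro A
      obtain ⟨C, hC⟩ := hw.bound A
      obtain ⟨C', hC'⟩ := hw'.bound A
      exact ⟨C + C', fun x hx t => (norm_sub_le _ _).trans (add_le_add (hC x hx t) (hC' x hx t))⟩
    obtain ⟨B, hB, hBb⟩ := rwn_fin hq hsupp hbd
    have key : ∀ x ∈ Icc (0:ℝ) 1, rwn q (fun x t => kS w x t - kS w' x t) x ≤
        Cq q * (2 * n + n * Φ) + Cq q * ∫⁻ s in Ioo 0 x, ‖w' s‖ₑ ^ q * rwn q (fun x t => kS w x t - kS w' x t) s := by
      intro x hx
      refine (diff_row hq hw hw' hx.2).trans ?_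
      rw [← mul_add]
      gcongr
      exact hmid x hx
    intro x hx
    refine (gron hk0 hB hBb key (fun x hx => hk w' h0 hw'.1 hc0 hM0 hη' x hx) x hx).trans_eq ?_
    rw [hP]; ring
  constructor
  · intro x hx
    refine (hrow x hx).trans ?_
    gcongr
    exact le_self_add
  · intro t
    refine (diff_col hq hw hw' t).trans ?_
    have h3 : ∫⁻ s in Ioo 0 1, ‖w' s‖ₑ ^ q * rwn q (fun x t => kS w x t - kS w' x t) s ≤ Bn * (P * n) := by
      calc _ ≤ ∫⁻ s in Ioo 0 1, ‖w' s‖ₑ ^ q * (P * n) := by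
            refine setLIntegral_mono' measurableSet_Ioo fun s hs => ?_
            gcongr
            exact hrow s ⟨hs.1.le, hs.2.le⟩
        _ = nq q w' * (P * n) := lintegral_mul_const _ (enorm_q_meas hw'.1.stronglyMeasurable q)
        _ ≤ _ := by gcongr; exact hnq w' hw' hη'
    calc _ ≤ Cq q * (2 * n + n * Φ + Bn * (P * n)) := by
          gcongr
          exact hmid 1 (by simp)
      _ = Cq q * (2 + Φ + Bn * P) * n := by ring
      _ ≤ _ := by gcongr; exact le_add_self

end stab

section kker

/-- `mvL A` is the matrix commuting with `B` whose first column is that of `A`. -/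
def mvL : M2 →L[ℂ] M2 := LinearMap.toContinuousLinearMap
  { toFun := fun A => !![A 0 0, -A 1 0; A 1 0, A 0 0]
    map_add' := by intro A B; ext i j; fin_cases i <;> fin_cases j <;> simp [add_comm]
    map_smul' := by intro c A; ext i j; fin_cases i <;> fin_cases j <;> simp }

theorem mvL_apply (A : M2) : mvL A = !![A 0 0, -A 1 0; A 1 0, A 0 0] := rfl

/-- The transformation kernel built from the kernel `kS w`. -/
def kK (w : ℝ → M2) (x t : ℝ) : M2 :=
  if 0 ≤ t ∧ t ≤ x ∧ x ≤ 1 then mvL (kS w x t) + mvL (kS w x (-t)) * Jmat else 0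

theorem kK_supp (w : ℝ → M2) (x t : ℝ) (h : ¬ (0 ≤ t ∧ t ≤ x ∧ x ≤ 1)) : kK w x t = 0 := by
  simp only [kK, if_neg h]

theorem kK_meas {w : ℝ → M2} (hw : BC w) : StronglyMeasurable (Function.uncurry (kK w)) := by
  have h1 : StronglyMeasurable fun z : ℝ × ℝ => kS w z.1 z.2 := hw.meas
  have h2 : StronglyMeasurable fun z : ℝ × ℝ => kS w z.1 (-z.2) :=
    hw.meas.comp_measurable (g := fun z : ℝ × ℝ => (z.1, -z.2)) (by fun_prop)
  have h3 := (mvL.continuous.comp_stronglyMeasurable h1).add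
    ((mvL.continuous.comp_stronglyMeasurable h2).mul (stronglyMeasurable_const (b := Jmat)))
  refine StronglyMeasurable.ite (p := fun z : ℝ × ℝ => 0 ≤ z.2 ∧ z.2 ≤ z.1 ∧ z.1 ≤ 1) ?_ h3 stronglyMeasurable_const
  exact (measurableSet_le measurable_const measurable_snd).inter
    ((measurableSet_le measurable_snd measurable_fst).inter (measurableSet_le measurable_fst measurable_const))

theorem kK_row_meas {w : ℝ → M2} (hw : BC w) (x : ℝ) : StronglyMeasurable (kK w x) :=
  (kK_meas hw).comp_measurable (g := fun t : ℝ => (x, t)) (by fun_prop)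
theorem kK_col_meas {w : ℝ → M2} (hw : BC w) (t : ℝ) : StronglyMeasurable (fun x => kK w x t) :=
  (kK_meas hw).comp_measurable (g := fun x : ℝ => (x, t)) (by fun_prop)

def mvC : ℝ := ‖mvL‖ * (1 + ‖Jmat‖)

theorem mvC_nonneg : 0 ≤ mvC := by unfold mvC; positivity

theorem mv_bound (A B : M2) : ‖mvL A + mvL B * Jmat‖ ≤ mvC * (‖A‖ + ‖B‖) := by
  have h1 := mvL.le_opNorm A
  have h2 := mvL.le_opNorm B
  have h3 : ‖mvL B * Jmat‖ ≤ ‖mvL‖ * ‖B‖ * ‖Jmat‖ :=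
    (norm_mul_le _ _).trans (mul_le_mul_of_nonneg_right h2 (norm_nonneg _))
  have := norm_add_le (mvL A) (mvL B * Jmat)
  have h4 : 0 ≤ ‖mvL‖ * ‖A‖ * ‖Jmat‖ := by positivity
  have h5 : 0 ≤ ‖mvL‖ * ‖B‖ := by positivity
  unfold mvC
  nlinarith

theorem kK_diff_pt (w w' : ℝ → M2) (x t : ℝ) :
    ‖kK w x t - kK w' x t‖ ≤ mvC * (‖kS w x t - kS w' x t‖ + ‖kS w x (-t) - kS w' x (-t)‖) := by
  unfold kK
  split_ifs
  · have : mvL (kS w x t) + mvL (kS w x (-t)) * Jmat - (mvL (kS w' x t) + mvL (kS w' x (-t)) * Jmat)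
      = mvL (kS w x t - kS w' x t) + mvL (kS w x (-t) - kS w' x (-t)) * Jmat := by
      rw [map_sub, map_sub, sub_mul]; abel
    rw [this]
    exact mv_bound _ _
  · simp only [sub_self, norm_zero]
    have := mvC_nonneg
    positivity

theorem kK_bound {w : ℝ → M2} (hw : BC w) : ∃ C : ℝ, ∀ x t, ‖kK w x t‖ ≤ C := by
  obtain ⟨C, hC⟩ := hw.bound 1
  have h0 : 0 ≤ C := (norm_nonneg _).trans (hC 0 zero_le_one 0)
  have hm := mvC_nonneg
  refine ⟨mvC * (C + C), fun x t => ?_⟩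
  unfold kK
  split_ifs with h
  · exact (mv_bound _ _).trans (mul_le_mul_of_nonneg_left (add_le_add (hC x h.2.2 t) (hC x h.2.2 (-t))) hm)
  · rw [norm_zero]; positivity

instance : IsFiniteMeasure μ01 := by unfold μ01; infer_instance

theorem kK_cont_form {w : ℝ → M2} (hw : BC w) {x t : ℝ} (h : |t| ≠ x) :
    ContinuousAt (fun z : ℝ × ℝ => mvL (kS w z.1 z.2) + mvL (kS w z.1 (-z.2)) * Jmat) (x, t) := by
  have h1 : ContinuousAt (fun z : ℝ × ℝ => kS w z.1 z.2) (x, t) := hw.contAt h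
  have h2 : ContinuousAt (fun z : ℝ × ℝ => kS w z.1 (-z.2)) (x, t) := by
    have := hw.contAt (x := x) (t := -t) (by rwa [abs_neg])
    exact ContinuousAt.comp (f := fun z : ℝ × ℝ => (z.1, -z.2)) (x := (x, t)) this (by fun_prop)
  exact (mvL.continuous.continuousAt.comp h1).add ((mvL.continuous.continuousAt.comp h2).mul continuousAt_const)

theorem kK_cont_row {w : ℝ → M2} (hw : BC w) {x₀ t : ℝ} (ht : 0 < t) (h : t ≠ x₀) :
    Tendsto (fun x => kK w x t) (𝓝[Icc 0 1] x₀) (𝓝 (kK w x₀ t)) := by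
  rcases lt_or_gt_of_ne h with h | h
  · by_cases hx1 : x₀ ≤ 1
    · have e : ∀ᶠ x in 𝓝[Icc 0 1] x₀, kK w x t = mvL (kS w x t) + mvL (kS w x (-t)) * Jmat := by
        filter_upwards [self_mem_nhdsWithin, mem_nhdsWithin_of_mem_nhds (lt_mem_nhds h)] with x hx hx'
        simp only [kK]
        rw [if_pos ⟨ht.le, le_of_lt hx', hx.2⟩]
      rw [tendsto_congr' e]
      have e0 : kK w x₀ t = mvL (kS w x₀ t) + mvL (kS w x₀ (-t)) * Jmat := by
        simp only [kK]; rw [if_pos ⟨ht.le, h.le, hx1⟩]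
      rw [e0]
      have := kK_cont_form hw (x := x₀) (t := t) (by rw [abs_of_pos ht]; exact h.ne)
      have := ContinuousAt.comp (f := fun x : ℝ => (x, t)) (x := x₀) this (by fun_prop)
      exact this.tendsto.mono_left nhdsWithin_le_nhds
    · have : 𝓝[Icc 0 1] x₀ = ⊥ := by
        rw [← notMem_closure_iff_nhdsWithin_eq_bot, isClosed_Icc.closure_eq]
        exact fun hh => hx1 hh.2
      rw [this]; exact tendsto_bot
  · have e : ∀ᶠ x in 𝓝[Icc 0 1] x₀, kK w x t = kK w x₀ t := by
      filter_upwards [mem_nhdsWithin_of_mem_nhds (gt_mem_nhds h)] with x hx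
      rw [kK_supp, kK_supp] <;> intro hh
      · linarith [hh.2.1]
      · exact absurd hx (not_lt.2 hh.2.1)
    exact (tendsto_congr' e).2 tendsto_const_nhds

theorem kK_cont_col {w : ℝ → M2} (hw : BC w) {x t₀ : ℝ} (ht0 : 0 ≤ t₀) (hx1 : x ≤ 1) (h : x ≠ t₀) :
    Tendsto (fun t => kK w x t) (𝓝[Icc 0 1] t₀) (𝓝 (kK w x t₀)) := by
  rcases lt_or_gt_of_ne h with h | h
  · have e : ∀ᶠ t in 𝓝[Icc 0 1] t₀, kK w x t = kK w x t₀ := by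
      filter_upwards [mem_nhdsWithin_of_mem_nhds (lt_mem_nhds h)] with t hx
      rw [kK_supp, kK_supp] <;> intro hh
      · linarith [hh.2.1]
      · exact absurd hx (not_lt.2 hh.2.1)
    exact (tendsto_congr' e).2 tendsto_const_nhds
  · have e : ∀ᶠ t in 𝓝[Icc 0 1] t₀, kK w x t = mvL (kS w x t) + mvL (kS w x (-t)) * Jmat := by
      filter_upwards [self_mem_nhdsWithin, mem_nhdsWithin_of_mem_nhds (gt_mem_nhds h)] with t ht ht'
      simp only [kK]
      rw [if_pos ⟨ht.1, le_of_lt ht', hx1⟩]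
    rw [tendsto_congr' e]
    have e0 : kK w x t₀ = mvL (kS w x t₀) + mvL (kS w x (-t₀)) * Jmat := by
      simp only [kK]; rw [if_pos ⟨ht0, h.le, hx1⟩]
    rw [e0]
    have := kK_cont_form hw (x := x) (t := t₀) (by rw [abs_of_nonneg ht0]; exact h.ne)
    have := ContinuousAt.comp (f := fun t : ℝ => (x, t)) (x := t₀) this (by fun_prop)
    exact this.tendsto.mono_left nhdsWithin_le_nhds

theorem slice_cont {p : ℝ≥0∞} (hp : 1 ≤ p) (hp' : p ≠ ∞) {F : ℝ → ℝ → M2} {C : ℝ}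
    (hb : ∀ y t, ‖F y t‖ ≤ C) (hm : ∀ y, StronglyMeasurable (F y)) (y₀ : ℝ)
    (hc : ∀ᵐ t ∂μ01, Tendsto (fun y => F y t) (𝓝[Icc 0 1] y₀) (𝓝 (F y₀ t))) :
    ∀ ε > (0:ℝ), ∃ δ > (0:ℝ), ∀ y ∈ Set.Icc (0:ℝ) 1,
    |y - y₀| < δ → eLpNorm (fun t => F y t - F y₀ t) p μ01 < ENNReal.ofReal ε := by
  have hp0 : p ≠ 0 := (zero_lt_one.trans_le hp).ne'
  have hq : 0 < p.toReal := ENNReal.toReal_pos hp0 hp'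
  have key : Tendsto (fun y => eLpNorm (fun t => F y t - F y₀ t) p μ01) (𝓝[Icc 0 1] y₀) (𝓝 0) := by
    simp_rw [eLpNorm_eq_lintegral_rpow_enorm_toReal hp0 hp']
    have h1 : Tendsto (fun y => ∫⁻ t, ‖F y t - F y₀ t‖ₑ ^ p.toReal ∂μ01) (𝓝[Icc 0 1] y₀) (𝓝 (∫⁻ t, 0 ∂μ01)) := by
      refine tendsto_lintegral_filter_of_dominated_convergence (fun _ => ENNReal.ofReal (C + C) ^ p.toReal)
        (Eventually.of_forall fun y => enorm_q_meas ((hm y).sub (hm y₀)) _)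
        (Eventually.of_forall fun y => Eventually.of_forall fun t => ?_) ?_ ?_
      · refine ENNReal.rpow_le_rpow ?_ hq.le
        rw [← ofReal_norm]
        exact ENNReal.ofReal_le_ofReal ((norm_sub_le _ _).trans (add_le_add (hb _ _) (hb _ _)))
      · rw [lintegral_const]
        exact ENNReal.mul_ne_top (ENNReal.rpow_ne_top_of_nonneg hq.le (by simp)) (measure_ne_top _ _)
      · filter_upwards [hc] with t ht
        have h2 : Tendsto (fun y => F y t - F y₀ t) (𝓝[Icc 0 1] y₀) (𝓝 0) := by
          simpa using ht.sub_const (F y₀ t)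
        have h3 := (ENNReal.continuous_rpow_const (y := p.toReal)).continuousAt.tendsto.comp h2.enorm
        simpa [Function.comp_def, ENNReal.zero_rpow_of_pos hq] using h3
    rw [lintegral_zero] at h1
    have h3 := (ENNReal.continuous_rpow_const (y := 1 / p.toReal)).continuousAt.tendsto.comp h1
    simpa [Function.comp_def, ENNReal.zero_rpow_of_pos (inv_pos.2 hq)] using h3
  intro ε hε
  have h4 := (tendsto_order.1 key).2 (ENNReal.ofReal ε) (by simpa using hε)
  obtain ⟨δ, hδ, H⟩ := Metric.mem_nhdsWithin_iff.1 h4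
  exact ⟨δ, hδ, fun y hy hyd => H ⟨by simpa [Real.dist_eq] using hyd, hy⟩⟩

theorem kK_memGp {p : ℝ≥0∞} (hp : 1 ≤ p) (hp' : p ≠ ∞) {w : ℝ → M2} (hw : BC w) : MemGp p (kK w) := by
  obtain ⟨C, hC⟩ := kK_bound hw
  refine ⟨fun x _ => MemLp.of_bound (kK_row_meas hw x).aestronglyMeasurable C (Eventually.of_forall (hC x)),
    fun t _ => MemLp.of_bound (kK_col_meas hw t).aestronglyMeasurable C (Eventually.of_forall fun x => hC x t), ?_, ?_⟩
  · intro x₀ hx₀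
    refine slice_cont hp hp' hC (kK_row_meas hw) x₀ ?_
    have h1 : ∀ᵐ t ∂μ01, t ∈ Ioo (0:ℝ) 1 := ae_restrict_mem measurableSet_Ioo
    have h2 : ∀ᵐ t ∂μ01, t ≠ x₀ := by
      refine ae_restrict_of_ae ?_
      simp [ae_iff]
    filter_upwards [h1, h2] with t ht ht'
    exact kK_cont_row hw ht.1 ht'
  · intro t₀ ht₀
    refine slice_cont (F := fun t x => kK w x t) hp hp' (fun t x => hC x t) (kK_col_meas hw) t₀ ?_
    have h1 : ∀ᵐ t ∂μ01, t ∈ Ioo (0:ℝ) 1 := ae_restrict_mem measurableSet_Ioo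
    have h2 : ∀ᵐ t ∂μ01, t ≠ t₀ := by
      refine ae_restrict_of_ae ?_
      simp [ae_iff]
    filter_upwards [h1, h2] with t ht ht'
    exact kK_cont_col hw ht₀.1 ht.2.le ht'

theorem eLp_q {p : ℝ≥0∞} (hp : 1 ≤ p) (hp' : p ≠ ∞) (f : ℝ → M2) :
    eLpNorm f p μ01 = (nq p.toReal f) ^ (1 / p.toReal) := by
  rw [eLpNorm_eq_lintegral_rpow_enorm_toReal (zero_lt_one.trans_le hp).ne' hp']; rfl

theorem eLp_q' {p : ℝ≥0∞} (hp : 1 ≤ p) (hp' : p ≠ ∞) (f : ℝ → M2) :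
    nq p.toReal f = eLpNorm f p μ01 ^ p.toReal := by
  have hq : 0 < p.toReal := ENNReal.toReal_pos (zero_lt_one.trans_le hp).ne' hp'
  rw [eLp_q hp hp', ← ENNReal.rpow_mul, one_div, inv_mul_cancel₀ hq.ne', ENNReal.rpow_one]

theorem mv_lint {q : ℝ} (hq : 1 ≤ q) {f a b : ℝ → M2} (h : ∀ s, ‖f s‖ ≤ mvC * (‖a s‖ + ‖b s‖))
    (ha : Measurable fun s => ‖a s‖ₑ ^ q) :
    nq q f ≤ ENNReal.ofReal mvC ^ q * (c1 q * (nq q a + nq q b)) := by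
  unfold nq
  rw [← lintegral_add_left ha, ← lintegral_const_mul' _ _ (c1_fin q), ← lintegral_const_mul' _ _
    (ENNReal.rpow_ne_top_of_nonneg (by linarith) (by simp))]
  refine lintegral_mono fun s => ?_
  have : ‖f s‖ₑ ≤ ENNReal.ofReal mvC * (‖a s‖ₑ + ‖b s‖ₑ) := by
    rw [← ofReal_norm, ← ofReal_norm, ← ofReal_norm, ← ENNReal.ofReal_add (norm_nonneg _) (norm_nonneg _),
      ← ENNReal.ofReal_mul mvC_nonneg]
    exact ENNReal.ofReal_le_ofReal (h s)
  refine (ENNReal.rpow_le_rpow this (by linarith)).trans ?_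
  rw [ENNReal.mul_rpow_of_nonneg _ _ (by linarith)]
  exact mul_le_mul_right (ENNReal.rpow_add_le_mul_rpow_add_rpow _ _ hq) _

theorem stabK {p : ℝ≥0∞} (hp : 1 ≤ p) (hp' : p ≠ ∞) :
    ∃ η : ℝ≥0∞, η ≠ 0 ∧ η ≠ ∞ ∧ ∀ h0 : ℝ → M2, BC h0 → ∃ L : ℝ≥0∞, L ≠ ∞ ∧
      ∀ w w' : ℝ → M2, BC w → BC w' → eLpNorm (fun s => w s - h0 s) p μ01 ≤ η →
        eLpNorm (fun s => w' s - h0 s) p μ01 ≤ η →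
        gpNorm p (fun x t => kK w x t - kK w' x t) ≤ L * eLpNorm (fun s => w s - w' s) p μ01 := by
  have hp0 : p ≠ 0 := (zero_lt_one.trans_le hp).ne'
  have hq0 : 0 < p.toReal := ENNReal.toReal_pos hp0 hp'
  have hq : 1 ≤ p.toReal := by
    rw [← ENNReal.toReal_one]; exact (ENNReal.toReal_le_toReal (by simp) hp').2 hp
  have hqi : 0 ≤ 1 / p.toReal := by positivity
  obtain ⟨η, h0, ht, H⟩ := stab (R := M2) hq
  refine ⟨η ^ (1 / p.toReal), (ENNReal.rpow_pos (pos_iff_ne_zero.2 h0) ht).ne',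
    ENNReal.rpow_ne_top_of_nonneg hqi ht, fun h0 hh0 => ?_⟩
  obtain ⟨L, hL, HL⟩ := H h0 hh0
  set D := ENNReal.ofReal mvC ^ p.toReal * (c1 p.toReal * (L + L)) with hD
  have hDf : D ≠ ∞ := ENNReal.mul_ne_top (ENNReal.rpow_ne_top_of_nonneg hq0.le (by simp))
    (ENNReal.mul_ne_top (c1_fin _) (ENNReal.add_ne_top.2 ⟨hL, hL⟩))
  refine ⟨D ^ (1 / p.toReal), ENNReal.rpow_ne_top_of_nonneg hqi hDf, fun w w' hw hw' hwη hw'η => ?_⟩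
  rw [eLp_q hp hp', ENNReal.rpow_le_rpow_iff (by positivity)] at hwη hw'η
  obtain ⟨hr, hc⟩ := HL w w' hw hw' hwη hw'η
  set n := nq p.toReal (fun s => w s - w' s) with hn
  have hDe : ENNReal.ofReal mvC ^ p.toReal * (c1 p.toReal * (L * n + L * n)) = D * n := by rw [hD]; ring
  have main : ∀ f : ℝ → M2, nq p.toReal f ≤ D * n → eLpNorm f p μ01 ≤ D ^ (1 / p.toReal) * eLpNorm (fun s => w s - w' s) p μ01 := by
    intro f hf
    rw [eLp_q hp hp', eLp_q hp hp', ← ENNReal.mul_rpow_of_nonneg _ _ hqi]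
    exact ENNReal.rpow_le_rpow hf hqi
  refine max_le (iSup₂_le fun x hx => main _ ?_) (iSup₂_le fun t _ => main _ ?_)
  · refine (mv_lint hq (fun t => kK_diff_pt w w' x t) (row_meas (hw.dmeas hw') x)).trans ?_
    rw [← hDe]
    refine mul_le_mul_right (mul_le_mul_right (add_le_add ?_ ?_) _) _
    · exact (setLIntegral_le_lintegral _ _).trans (hr x hx)
    · refine (setLIntegral_le_lintegral _ _).trans (le_trans (le_of_eq ?_) (hr x hx))
      exact lintegral_neg_eq_self (fun t => ‖kS w x t - kS w' x t‖ₑ ^ p.toReal)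
  · refine (mv_lint hq (fun x => kK_diff_pt w w' x t) (col_meas (hw.dmeas hw') t)).trans ?_
    rw [← hDe]
    refine mul_le_mul_right (mul_le_mul_right (add_le_add ?_ ?_) _) _
    · exact hc t
    · exact hc (-t)

end kker

section limk

theorem slice_lim {p : ℝ≥0∞} (hp : 1 ≤ p) {f : ℕ → ℝ → M2} (hf : ∀ n, MemLp (f n) p μ01)
    {B : ℕ → ℝ≥0∞} (hB : ∑' i, B i ≠ ∞)
    (hc : ∀ N n m, N ≤ n → N ≤ m → eLpNorm (fun s => f n s - f m s) p μ01 < B N) :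
    MemLp (fun s => limUnder atTop fun n => f n s) p μ01 ∧
    ∀ N, eLpNorm (fun s => (limUnder atTop fun n => f n s) - f N s) p μ01 ≤ B N := by
  have hm := fun n => (hf n).aestronglyMeasurable
  have hae : ∀ᵐ s ∂μ01, Tendsto (fun n => f n s) atTop (𝓝 (limUnder atTop fun n => f n s)) := by
    filter_upwards [Lp.ae_tendsto_of_cauchy_eLpNorm hm hp hB hc] with s hs
    obtain ⟨l, hl⟩ := hs
    rwa [hl.limUnder_eq]
  have hml := aestronglyMeasurable_of_tendsto_ae atTop hm hae
  have h2 : ∀ N, eLpNorm (fun s => (limUnder atTop fun n => f n s) - f N s) p μ01 ≤ B N := by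
    intro N
    have := Lp.eLpNorm_lim_le_liminf_eLpNorm (p := p) (f := fun n s => f n s - f N s) (μ := μ01)
      (fun n => (hm n).sub (hm N)) (fun s => (limUnder atTop fun n => f n s) - f N s) (by
        filter_upwards [hae] with s hs
        exact hs.sub_const _)
    refine this.trans (liminf_le_of_frequently_le' (Eventually.frequently ?_))
    filter_upwards [eventually_ge_atTop N] with n hn
    exact (hc N n N hn le_rfl).le
  refine ⟨?_, h2⟩
  have h3 : MemLp (fun s => (limUnder atTop fun n => f n s) - f 0 s) p μ01 :=
    ⟨hml.sub (hm 0), (h2 0).trans_lt (ENNReal.ne_top_of_tsum_ne_top hB 0).lt_top⟩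
  have e : (fun s => limUnder atTop fun n => f n s) = (fun s => (limUnder atTop fun n => f n s) - f 0 s) + f 0 := by
    funext s; simp only [Pi.add_apply, sub_add_cancel]
  rw [e]; exact h3.add (hf 0)

theorem row_le_gp (p : ℝ≥0∞) (K : ℝ → ℝ → M2) {x : ℝ} (hx : x ∈ Icc (0:ℝ) 1) :
    eLpNorm (K x) p μ01 ≤ gpNorm p K :=
  (le_iSup₂ (f := fun x (_ : x ∈ Icc (0:ℝ) 1) => eLpNorm (K x) p μ01) x hx).trans (le_max_left _ _)

theorem col_le_gp (p : ℝ≥0∞) (K : ℝ → ℝ → M2) {t : ℝ} (ht : t ∈ Icc (0:ℝ) 1) :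
    eLpNorm (fun x => K x t) p μ01 ≤ gpNorm p K :=
  (le_iSup₂ (f := fun t (_ : t ∈ Icc (0:ℝ) 1) => eLpNorm (fun x => K x t) p μ01) t ht).trans (le_max_right _ _)

theorem eLp_tri {p : ℝ≥0∞} (hp : 1 ≤ p) {f g h : ℝ → M2} (hf : AEStronglyMeasurable f μ01)
    (hg : AEStronglyMeasurable g μ01) (hh : AEStronglyMeasurable h μ01) :
    eLpNorm (fun s => f s - h s) p μ01 ≤ eLpNorm (fun s => f s - g s) p μ01 + eLpNorm (fun s => g s - h s) p μ01 := by
  have := eLpNorm_add_le (hf.sub hg) (hg.sub hh) hp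
  rw [sub_add_sub_cancel] at this
  exact this

theorem eLp_comm {p : ℝ≥0∞} (f g : ℝ → M2) :
    eLpNorm (fun s => f s - g s) p μ01 = eLpNorm (fun s => g s - f s) p μ01 :=
  eLpNorm_sub_comm f g p μ01

theorem gp_tri {p : ℝ≥0∞} (hp : 1 ≤ p) {F G H : ℝ → ℝ → M2} (hF : MemGp p F) (hG : MemGp p G) (hH : MemGp p H) :
    gpNorm p (fun x t => F x t - H x t) ≤ gpNorm p (fun x t => F x t - G x t) + gpNorm p (fun x t => G x t - H x t) := by
  refine max_le (iSup₂_le fun x hx => ?_) (iSup₂_le fun t ht => ?_)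
  · exact (eLp_tri hp (hF.1 x hx).1 (hG.1 x hx).1 (hH.1 x hx).1).trans
      (add_le_add (row_le_gp p (fun x t => F x t - G x t) hx) (row_le_gp p (fun x t => G x t - H x t) hx))
  · exact (eLp_tri hp (hF.2.1 t ht).1 (hG.2.1 t ht).1 (hH.2.1 t ht).1).trans
      (add_le_add (col_le_gp p (fun x t => F x t - G x t) ht) (col_le_gp p (fun x t => G x t - H x t) ht))

theorem gp_comm (p : ℝ≥0∞) (F G : ℝ → ℝ → M2) :
    gpNorm p (fun x t => F x t - G x t) = gpNorm p (fun x t => G x t - F x t) := by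
  exact congrArg₂ max (iSup_congr fun x => iSup_congr fun _ => eLp_comm (F x) (G x))
    (iSup_congr fun x => iSup_congr fun _ => eLp_comm (fun y => F y x) (fun y => G y x))

theorem three_eps {p : ℝ≥0∞} (hp : 1 ≤ p) {F : ℝ → ℝ → M2} {f : ℕ → ℝ → ℝ → M2} {B : ℕ → ℝ≥0∞}
    (hB : Tendsto B atTop (𝓝 0)) (hF : ∀ x ∈ Icc (0:ℝ) 1, MemLp (F x) p μ01)
    (hf : ∀ n, ∀ x ∈ Icc (0:ℝ) 1, MemLp (f n x) p μ01)
    (hd : ∀ n, ∀ x ∈ Icc (0:ℝ) 1, eLpNorm (fun t => F x t - f n x t) p μ01 ≤ B n)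
    (hc : ∀ n, ∀ x₀ ∈ Set.Icc (0:ℝ) 1, ∀ ε > (0:ℝ), ∃ δ > (0:ℝ), ∀ x ∈ Set.Icc (0:ℝ) 1,
    |x - x₀| < δ → eLpNorm (fun t => f n x t - f n x₀ t) p μ01 < ENNReal.ofReal ε) :
    ∀ x₀ ∈ Set.Icc (0:ℝ) 1, ∀ ε > (0:ℝ), ∃ δ > (0:ℝ), ∀ x ∈ Set.Icc (0:ℝ) 1,
    |x - x₀| < δ → eLpNorm (fun t => F x t - F x₀ t) p μ01 < ENNReal.ofReal ε := by
  intro x₀ hx₀ ε hε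
  obtain ⟨n, hn⟩ := ((tendsto_order.1 hB).2 (ENNReal.ofReal (ε / 3)) (by simpa using hε)).exists
  obtain ⟨δ, hδ, H⟩ := hc n x₀ hx₀ (ε / 3) (by positivity)
  refine ⟨δ, hδ, fun x hx hxd => ?_⟩
  have h1 := eLp_tri hp (hF x hx).1 (hf n x hx).1 (hF x₀ hx₀).1
  have h2 := eLp_tri hp (hf n x hx).1 (hf n x₀ hx₀).1 (hF x₀ hx₀).1
  have h3 := (hd n x hx).trans_lt hn
  have h4 := (hd n x₀ hx₀).trans_lt hn
  rw [eLp_comm] at h4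
  have h5 := H x hx hxd
  calc _ ≤ _ := h1
    _ ≤ _ := add_le_add le_rfl h2
    _ < ENNReal.ofReal (ε / 3) + (ENNReal.ofReal (ε / 3) + ENNReal.ofReal (ε / 3)) :=
      ENNReal.add_lt_add h3 (ENNReal.add_lt_add h5 h4)
    _ = ENNReal.ofReal ε := by
      rw [← ENNReal.ofReal_add (by positivity) (by positivity), ← ENNReal.ofReal_add (by positivity) (by positivity)]
      congr 1; ring

theorem gp_complete {p : ℝ≥0∞} (hp : 1 ≤ p) {f : ℕ → ℝ → ℝ → M2} (hf : ∀ n, MemGp p (f n))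
    {B : ℕ → ℝ≥0∞} (hB : ∑' i, B i ≠ ∞)
    (hc : ∀ N n m, N ≤ n → N ≤ m → gpNorm p (fun x t => f n x t - f m x t) < B N) :
    ∃ F : ℝ → ℝ → M2, MemGp p F ∧ (∀ x t, (∀ n, f n x t = 0) → F x t = 0) ∧
      ∀ N, gpNorm p (fun x t => F x t - f N x t) ≤ B N := by
  have hB0 : Tendsto B atTop (𝓝 0) := by
    have := ENNReal.tendsto_cofinite_zero_of_tsum_ne_top hB
    rwa [Nat.cofinite_eq_atTop] at this
  have hr := fun x (hx : x ∈ Icc (0:ℝ) 1) => slice_lim hp (fun n => (hf n).1 x hx) hB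
    (fun N n m hn hm => (row_le_gp p (fun x t => f n x t - f m x t) hx).trans_lt (hc N n m hn hm))
  have hcl := fun t (ht : t ∈ Icc (0:ℝ) 1) => slice_lim hp (fun n => (hf n).2.1 t ht) hB
    (fun N n m hn hm => (col_le_gp p (fun x t => f n x t - f m x t) ht).trans_lt (hc N n m hn hm))
  refine ⟨fun x t => limUnder atTop fun n => f n x t, ⟨fun x hx => (hr x hx).1, fun t ht => (hcl t ht).1, ?_, ?_⟩, ?_, ?_⟩
  · exact three_eps hp hB0 (fun x hx => (hr x hx).1) (fun n => (hf n).1) (fun n x hx => (hr x hx).2 n)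
      (fun n => (hf n).2.2.1)
  · exact three_eps (F := fun t x => limUnder atTop fun n => f n x t) (f := fun n t x => f n x t) hp hB0
      (fun x hx => (hcl x hx).1) (fun n => (hf n).2.1) (fun n x hx => (hcl x hx).2 n)
      (fun n => (hf n).2.2.2)
  · intro x t h
    simp only [h]
    exact tendsto_const_nhds.limUnder_eq
  · intro N
    exact max_le (iSup₂_le fun x hx => (hr x hx).2 N) (iSup₂_le fun t ht => (hcl t ht).2 N)

/-- bounded continuous functions anticommuting with `B` -/
def Nice (w : ℝ → M2) : Prop := BC w ∧ ∀ s, Bmat * w s = -(w s * Bmat)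

theorem BC.memLp {w : ℝ → M2} (hw : BC w) (p : ℝ≥0∞) : MemLp w p μ01 := by
  obtain ⟨hc, M, _, hb⟩ := hw
  exact MemLp.of_bound hc.stronglyMeasurable.aestronglyMeasurable M (Eventually.of_forall hb)

theorem Bsq : Bmat * Bmat = -1 := by
  ext i j; fin_cases i <;> fin_cases j <;> simp [Bmat, Matrix.mul_apply]

theorem nice_dense {p : ℝ≥0∞} (hp' : p ≠ ∞) {W : ℝ → M2} (hW : MemLp W p μ01)
    (ha : ∀ s, Bmat * W s = -(W s * Bmat)) {ε : ℝ≥0∞} (hε : ε ≠ 0) :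
    ∃ h, Nice h ∧ eLpNorm (fun s => W s - h s) p μ01 ≤ ε := by
  have : μ01.WeaklyRegular := by unfold μ01; infer_instance
  set c : ℝ := 1 + ‖Bmat‖ * ‖Bmat‖ with hc
  have hc0 : 0 < c := by positivity
  have hε' : ε / ENNReal.ofReal c ≠ 0 := by
    simp [ENNReal.div_eq_zero_iff, hε]
  obtain ⟨g, hg, _⟩ := hW.exists_boundedContinuous_eLpNorm_sub_le hp' hε'
  have hgc : Continuous fun s => (2⁻¹ : ℝ) • (g s + Bmat * g s * Bmat) := by
    have h1 : Continuous fun s => g s := g.continuous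
    fun_prop
  have hnb : ∀ A : M2, ‖(2⁻¹ : ℝ) • (A + Bmat * A * Bmat)‖ ≤ c * ‖A‖ := by
    intro A
    rw [norm_smul]
    have h1 : ‖A + Bmat * A * Bmat‖ ≤ ‖A‖ + ‖Bmat‖ * ‖A‖ * ‖Bmat‖ :=
      (norm_add_le _ _).trans (add_le_add le_rfl ((norm_mul_le _ _).trans
        (mul_le_mul_of_nonneg_right (norm_mul_le _ _) (norm_nonneg _))))
    have h2 : ‖(2⁻¹ : ℝ)‖ ≤ 1 := by norm_num
    calc _ ≤ 1 * ‖A + Bmat * A * Bmat‖ := mul_le_mul_of_nonneg_right h2 (norm_nonneg _)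
      _ ≤ ‖A‖ + ‖Bmat‖ * ‖A‖ * ‖Bmat‖ := by rw [one_mul]; exact h1
      _ = _ := by rw [hc]; ring
  refine ⟨fun s => (2⁻¹ : ℝ) • (g s + Bmat * g s * Bmat), ⟨⟨hgc, c * ‖g‖ + 1, by positivity, ?_⟩, ?_⟩, ?_⟩
  · intro s
    have := mul_le_mul_of_nonneg_left (g.norm_coe_le_norm s) hc0.le
    linarith [hnb (g s)]
  · intro s
    have e1 : Bmat * (Bmat * g s * Bmat) = -(g s * Bmat) := by
      rw [mul_assoc, ← mul_assoc, Bsq, neg_one_mul]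
    have e2 : (Bmat * g s * Bmat) * Bmat = -(Bmat * g s) := by
      rw [mul_assoc, Bsq, mul_neg_one]
    rw [mul_smul_comm, smul_mul_assoc, mul_add, add_mul, e1, e2, ← smul_neg]
    congr 1; abel
  · have e : ∀ s, W s - (2⁻¹ : ℝ) • (g s + Bmat * g s * Bmat)
        = (2⁻¹ : ℝ) • ((W s - g s) + Bmat * (W s - g s) * Bmat) := by
      intro s
      have : Bmat * W s * Bmat = W s := by
        rw [ha, neg_mul, mul_assoc, Bsq, mul_neg_one, neg_neg]
      rw [mul_sub, sub_mul, this]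
      have : W s = (2⁻¹ : ℝ) • (W s + W s) := by
        rw [← two_smul ℝ (W s), smul_smul]; norm_num
      nth_rewrite 1 [this]
      rw [← smul_sub]; congr 1; abel
    have := eLpNorm_le_mul_eLpNorm_of_ae_le_mul (μ := μ01) (f := fun s => W s - (2⁻¹ : ℝ) • (g s + Bmat * g s * Bmat))
      (g := W - ⇑g) (c := c) (Eventually.of_forall fun s => by rw [e s]; exact hnb _) p
    refine this.trans ((mul_le_mul_right hg _).trans ?_)
    rw [ENNReal.mul_div_cancel (by simpa using hc0) (by simp)]

theorem limit_kernel {p : ℝ≥0∞} (hp : 1 ≤ p) (hp' : p ≠ ∞) {W : ℝ → M2} (hW : MemLp W p μ01)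
    (ha : ∀ s, Bmat * W s = -(W s * Bmat)) :
    ∃ K : ℝ → ℝ → M2, MemGp p K ∧ (∀ x t : ℝ, ¬ (0 ≤ t ∧ t ≤ x ∧ x ≤ 1) → K x t = 0) ∧
      ∃ η L : ℝ≥0∞, η ≠ 0 ∧ L ≠ ∞ ∧ ∀ h, Nice h → eLpNorm (fun s => W s - h s) p μ01 ≤ η →
        gpNorm p (fun x t => K x t - kK h x t) ≤ L * eLpNorm (fun s => W s - h s) p μ01 := by
  obtain ⟨η, hη0, hηt, H⟩ := stabK hp hp'
  have h2 : ∀ n : ℕ, min (η / 2) (2⁻¹ ^ n) ≠ (0 : ℝ≥0∞) := by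
    intro n
    rw [Ne, ← nonpos_iff_eq_zero, min_le_iff, not_or]
    constructor
    · simp [ENNReal.div_eq_zero_iff, hη0]
    · simp
  choose g hg hgW using fun n => nice_dense hp' hW ha (h2 n)
  obtain ⟨L, hL, HL⟩ := H (g 0) (hg 0).1
  have hWm := hW.1
  have hgm : ∀ h, BC h → AEStronglyMeasurable h μ01 := fun h hh => (hh.memLp p).1
  have hηη : η / 2 + η / 2 = η := ENNReal.add_halves η
  have hnear : ∀ h, BC h → eLpNorm (fun s => W s - h s) p μ01 ≤ η / 2 → eLpNorm (fun s => h s - g 0 s) p μ01 ≤ η := by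
    intro h hh hle
    refine (eLp_tri hp (hgm h hh) hWm (hgm _ (hg 0).1)).trans ?_
    rw [← hηη, eLp_comm h W]
    exact add_le_add hle ((hgW 0).trans (min_le_left _ _))
  set B : ℕ → ℝ≥0∞ := fun n => (L * 2 + 1) * 2⁻¹ ^ n with hBdef
  have hL2 : L * 2 ≠ ∞ := ENNReal.mul_ne_top hL (by simp)
  have hB : ∑' i, B i ≠ ∞ := by
    rw [ENNReal.tsum_mul_left, ENNReal.tsum_geometric, ENNReal.one_sub_inv_two, inv_inv]
    exact ENNReal.mul_ne_top (ENNReal.add_ne_top.2 ⟨hL2, by simp⟩) (by simp)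
  have hpow : ∀ n : ℕ, (2⁻¹ : ℝ≥0∞) ^ n ≠ ∞ := fun n => ENNReal.pow_ne_top (by simp)
  have hcau : ∀ N n m, N ≤ n → N ≤ m → gpNorm p (fun x t => kK (g n) x t - kK (g m) x t) < B N := by
    intro N n m hn hm
    have hle : ∀ n, N ≤ n → eLpNorm (fun s => W s - g n s) p μ01 ≤ 2⁻¹ ^ N := fun n hn =>
      ((hgW n).trans (min_le_right _ _)).trans (pow_le_pow_right_of_le_one' (by simp) hn)
    calc _ ≤ L * eLpNorm (fun s => g n s - g m s) p μ01 :=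
          HL _ _ (hg n).1 (hg m).1 (hnear _ (hg n).1 ((hgW n).trans (min_le_left _ _)))
            (hnear _ (hg m).1 ((hgW m).trans (min_le_left _ _)))
      _ ≤ L * (2⁻¹ ^ N + 2⁻¹ ^ N) := by
          refine mul_le_mul_right ((eLp_tri hp (hgm _ (hg n).1) hWm (hgm _ (hg m).1)).trans ?_) _
          rw [eLp_comm (g n) W]
          exact add_le_add (hle n hn) (hle m hm)
      _ = L * 2 * 2⁻¹ ^ N := by ring
      _ < B N := by
          rw [hBdef]
          simp only [add_mul, one_mul]
          exact ENNReal.lt_add_right (ENNReal.mul_ne_top hL2 (hpow N)) (by simp)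
  obtain ⟨K, hK, hK0, hKn⟩ := gp_complete hp (fun n => kK_memGp hp hp' (hg n).1) hB hcau
  refine ⟨K, hK, fun x t h => hK0 x t fun n => kK_supp _ x t h, η / 2, L, by simp [ENNReal.div_eq_zero_iff, hη0], hL, ?_⟩
  intro h hh hle
  have hbd : ∀ n, gpNorm p (fun x t => K x t - kK h x t) ≤ B n + L * (2⁻¹ ^ n + eLpNorm (fun s => W s - h s) p μ01) := by
    intro n
    refine (gp_tri hp hK (kK_memGp hp hp' (hg n).1) (kK_memGp hp hp' hh.1)).trans (add_le_add (hKn n) ?_)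
    refine (HL _ _ (hg n).1 hh.1 (hnear _ (hg n).1 ((hgW n).trans (min_le_left _ _))) (hnear _ hh.1 hle)).trans ?_
    refine mul_le_mul_right ((eLp_tri hp (hgm _ (hg n).1) hWm (hgm _ hh.1)).trans ?_) _
    rw [eLp_comm (g n) W]
    exact add_le_add ((hgW n).trans (min_le_right _ _)) le_rfl
  have hp0 : Tendsto (fun n : ℕ => (2⁻¹ : ℝ≥0∞) ^ n) atTop (𝓝 0) :=
    ENNReal.tendsto_pow_atTop_nhds_zero_of_lt_one (by simp)
  have hB0 : Tendsto B atTop (𝓝 0) := by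
    have := ENNReal.tendsto_cofinite_zero_of_tsum_ne_top hB
    rwa [Nat.cofinite_eq_atTop] at this
  have hlim : Tendsto (fun n => B n + L * (2⁻¹ ^ n + eLpNorm (fun s => W s - h s) p μ01)) atTop
      (𝓝 (0 + L * (0 + eLpNorm (fun s => W s - h s) p μ01))) :=
    hB0.add (ENNReal.Tendsto.const_mul (hp0.add tendsto_const_nhds) (Or.inr hL))
  simpa using ge_of_tendsto' hlim hbd

end limk

section duh

/-- `EE l τ = e^{-λ τ B}` -/
def EE (l : ℂ) (τ : ℝ) : M2 := expB (l * τ)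

theorem EE_eq (l : ℂ) (τ : ℝ) : EE l τ = Complex.cos (l * τ) • (1 : M2) - Complex.sin (l * τ) • Bmat := by
  ext i j; fin_cases i <;> fin_cases j <;> simp [EE, expB, Bmat]

theorem EE_zero (l : ℂ) : EE l 0 = 1 := by simp [EE_eq]

theorem EE_add (l : ℂ) (a b : ℝ) : EE l (a + b) = EE l a * EE l b := by
  have h1 := Complex.cos_add (l * a) (l * b)
  have h2 := Complex.sin_add (l * a) (l * b)
  rw [← mul_add] at h1 h2
  ext i j; fin_cases i <;> fin_cases j <;>
    simp [EE, expB, Matrix.mul_apply, h1, h2] <;> ring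

theorem EE_anti (l : ℂ) (τ : ℝ) {A : M2} (hA : Bmat * A = -(A * Bmat)) : A * EE l τ = EE l (-τ) * A := by
  rw [EE_eq, EE_eq, mul_sub, sub_mul, mul_smul_comm, mul_smul_comm, smul_mul_assoc, smul_mul_assoc, hA]
  simp

theorem EE_cont (l : ℂ) : Continuous (EE l) := by
  have : EE l = fun τ : ℝ => Complex.cos (l * τ) • (1 : M2) - Complex.sin (l * τ) • Bmat := funext (EE_eq l)
  rw [this]
  have h : Continuous fun τ : ℝ => l * (τ : ℂ) := by fun_prop
  exact ((Complex.continuous_cos.comp h).smul continuous_const).sub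
    ((Complex.continuous_sin.comp h).smul continuous_const)

theorem EE_bound (l : ℂ) : ∃ C : ℝ, 0 < C ∧ ∀ τ ∈ Icc (-1:ℝ) 1, ‖EE l τ‖ ≤ C := by
  obtain ⟨C, hC⟩ := isCompact_Icc.exists_bound_of_continuousOn (s := Icc (-1:ℝ) 1) (EE_cont l).continuousOn
  exact ⟨|C| + 1, by positivity, fun τ h => by linarith [hC τ h, le_abs_self C]⟩

/-- embedding of vectors as first columns -/
def iot : (Fin 2 → ℂ) →L[ℂ] M2 := LinearMap.toContinuousLinearMap
  { toFun := fun v => !![v 0, 0; v 1, 0]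
    map_add' := by intro A B; ext i j; fin_cases i <;> fin_cases j <;> simp
    map_smul' := by intro c A; ext i j; fin_cases i <;> fin_cases j <;> simp }

theorem iot_apply (v : Fin 2 → ℂ) : iot v = !![v 0, 0; v 1, 0] := rfl

/-- first column -/
def col0 : M2 →L[ℂ] (Fin 2 → ℂ) := LinearMap.toContinuousLinearMap
  { toFun := fun A => ![A 0 0, A 1 0]
    map_add' := by intro A B; ext i; fin_cases i <;> simp
    map_smul' := by intro c A; ext i; fin_cases i <;> simp }

theorem col0_apply (A : M2) : col0 A = ![A 0 0, A 1 0] := rfl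

theorem col0_iot (v : Fin 2 → ℂ) : col0 (iot v) = v := by
  ext i; fin_cases i <;> simp [col0_apply, iot_apply]

theorem iot_mulVec (A : M2) (v : Fin 2 → ℂ) : iot (A.mulVec v) = A * iot v := by
  ext i j; fin_cases i <;> fin_cases j <;>
    simp [iot_apply, Matrix.mul_apply, Fin.sum_univ_two]

theorem cos_ac (l : ℂ) : AbsolutelyContinuousOnInterval (fun τ : ℝ => Complex.cos (l * τ)) 0 1 := by
  apply ContDiffOn.absolutelyContinuousOnInterval
  apply ContDiff.contDiffOn
  have h : ContDiff ℝ 1 fun τ : ℝ => l * (τ : ℂ) := contDiff_const.mul Complex.ofRealCLM.contDiff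
  exact (Complex.contDiff_cos.restrict_scalars ℝ).comp h

theorem sin_ac (l : ℂ) : AbsolutelyContinuousOnInterval (fun τ : ℝ => Complex.sin (l * τ)) 0 1 := by
  apply ContDiffOn.absolutelyContinuousOnInterval
  apply ContDiff.contDiffOn
  have h : ContDiff ℝ 1 fun τ : ℝ => l * (τ : ℂ) := contDiff_const.mul Complex.ofRealCLM.contDiff
  exact (Complex.contDiff_sin.restrict_scalars ℝ).comp h

theorem cos_der (l : ℂ) (τ : ℝ) : HasDerivAt (fun τ : ℝ => Complex.cos (l * τ)) (-Complex.sin (l * τ) * l) τ := by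
  have h : HasDerivAt (fun z : ℂ => l * z) l (τ : ℂ) := by
    simpa using (hasDerivAt_id (τ : ℂ)).const_mul l
  exact h.ccos.comp_ofReal

theorem sin_der (l : ℂ) (τ : ℝ) : HasDerivAt (fun τ : ℝ => Complex.sin (l * τ)) (Complex.cos (l * τ) * l) τ := by
  have h : HasDerivAt (fun z : ℂ => l * z) l (τ : ℂ) := by
    simpa using (hasDerivAt_id (τ : ℂ)).const_mul l
  exact h.csin.comp_ofReal

theorem ac_int {z : ℝ → M2} (hz : IntervalIntegrable z volume 0 1) :
    AbsolutelyContinuousOnInterval (fun x => ∫ t in (0:ℝ)..x, z t) 0 1 := by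
  have h1 := hz.norm.absolutelyContinuousOnInterval_intervalIntegral (c := 0) (by simp)
  rw [absolutelyContinuousOnInterval_iff] at h1 ⊢
  intro ε hε
  obtain ⟨δ, hδ, H⟩ := h1 ε hε
  refine ⟨δ, hδ, fun E hE hEd => lt_of_le_of_lt (Finset.sum_le_sum fun i hi => ?_) (H E hE hEd)⟩
  have hm := hE.1 i hi
  have hsub : ∀ y ∈ uIcc (0:ℝ) 1, IntervalIntegrable z volume 0 y := fun y hy =>
    hz.mono_set (uIcc_subset_uIcc_left hy)
  rw [dist_eq_norm, dist_eq_norm, intervalIntegral.integral_interval_sub_left (hsub _ hm.1) (hsub _ hm.2),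
    intervalIntegral.integral_interval_sub_left (hsub _ hm.1).norm (hsub _ hm.2).norm]
  exact intervalIntegral.norm_integral_le_abs_integral_norm

theorem ac_const (Z0 : M2) (a b : ℝ) : AbsolutelyContinuousOnInterval (fun _ : ℝ => Z0) a b :=
  ContDiffOn.absolutelyContinuousOnInterval contDiff_const.contDiffOn

theorem duh1 (l : ℂ) (Z0 : M2) {z : ℝ → M2} (hz : IntervalIntegrable z volume 0 1) :
    IntervalIntegrable (fun s => EE l (-s) * (z s + l • (Bmat * (Z0 + ∫ t in (0:ℝ)..s, z t)))) volume 0 1 ∧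
    ∀ x ∈ Icc (0:ℝ) 1, EE l (-x) * (Z0 + ∫ t in (0:ℝ)..x, z t) = Z0 +
      ∫ s in (0:ℝ)..x, EE l (-s) * (z s + l • (Bmat * (Z0 + ∫ t in (0:ℝ)..s, z t))) := by
  set Zf : ℝ → M2 := fun x => Z0 + ∫ t in (0:ℝ)..x, z t with hZf
  have hzac := ac_int hz
  have hZac : AbsolutelyContinuousOnInterval Zf 0 1 := (ac_const Z0 0 1).add hzac
  have hZc : ContinuousOn Zf (Icc 0 1) := by simpa using hZac.continuousOn
  have hBz : IntervalIntegrable (fun s => Bmat * z s) volume 0 1 := by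
    have := hz.continuousOn_mul (f := z) (g := fun _ => Bmat) continuousOn_const
    exact this
  have hBZ : ∀ x ∈ Icc (0:ℝ) 1, Bmat * Zf x = Bmat * Z0 + ∫ t in (0:ℝ)..x, Bmat * z t := by
    intro x hx
    have hzx : IntervalIntegrable z volume 0 x := hz.mono_set (by
      rw [uIcc_of_le hx.1, uIcc_of_le zero_le_one]; exact Icc_subset_Icc_right hx.2)
    have : ∫ t in (0:ℝ)..x, Bmat * z t = Bmat * ∫ t in (0:ℝ)..x, z t :=
      (ContinuousLinearMap.mul ℝ M2 Bmat).intervalIntegral_comp_comm hzx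
    rw [this, ← mul_add]
  have hEn : ∀ s : ℝ, ∀ A : M2, EE l (-s) * A = Complex.cos (l * s) • A + Complex.sin (l * s) • (Bmat * A) := by
    intro s A
    rw [EE_eq]
    simp [add_mul]
  set G : ℝ → M2 := fun s => EE l (-s) * (z s + l • (Bmat * Zf s)) with hG
  have hGi : IntervalIntegrable G volume 0 1 := by
    have h1 : IntervalIntegrable (fun s => l • (Bmat * Zf s)) volume 0 1 := by
      apply ContinuousOn.intervalIntegrable
      rw [uIcc_of_le zero_le_one]
      exact (continuousOn_const.mul hZc).const_smul l
    have h2 : ContinuousOn (fun s : ℝ => EE l (-s)) (uIcc 0 1) := ((EE_cont l).comp continuous_neg).continuousOn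
    exact (hz.add h1).continuousOn_mul h2
  refine ⟨hGi, ?_⟩
  have hGac := ac_int hGi
  have hBac : AbsolutelyContinuousOnInterval (fun x => Bmat * Z0 + ∫ t in (0:ℝ)..x, Bmat * z t) 0 1 :=
    (ac_const (Bmat * Z0) 0 1).add (ac_int hBz)
  have hfac := (((cos_ac l).smul hZac).add ((sin_ac l).smul hBac)).sub hGac
  obtain ⟨C, hC⟩ := hfac.const_of_ae_hasDerivAt_zero (by
    filter_upwards [hz.ae_hasDerivAt_integral, hBz.ae_hasDerivAt_integral, hGi.ae_hasDerivAt_integral] with x h1 h2 h3 hx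
    have h1 := (h1 hx 0 (by simp)).const_add Z0
    have h2 := (h2 hx 0 (by simp)).const_add (Bmat * Z0)
    have h3 := h3 hx 0 (by simp)
    have := (((cos_der l x).smul h1).add ((sin_der l x).smul h2)).sub h3
    refine this.congr_deriv ?_
    have hx' : x ∈ Icc (0:ℝ) 1 := by simpa using hx
    have e := hBZ x hx'
    rw [← e]
    have e2 : Z0 + ∫ t in (0:ℝ)..x, z t = Zf x := rfl
    rw [e2, hG]
    simp only
    rw [hEn, mul_add Bmat (z x), mul_smul_comm, ← mul_assoc, Bsq]
    simp only [smul_add, smul_smul, neg_mul, one_mul, neg_smul, smul_neg]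
    abel)
  intro x hx
  have hx' : x ∈ uIcc (0:ℝ) 1 := by simpa using hx
  have c1 := hC x hx'
  have c2 := hC 0 (by simp)
  rw [← c2] at c1
  simp only [Pi.sub_apply, Pi.add_apply, Pi.smul_apply', intervalIntegral.integral_same, mul_zero,
    Complex.cos_zero, Complex.sin_zero, zero_smul, one_smul, add_zero, sub_zero, Complex.ofReal_zero] at c1
  have hZ00 : Zf 0 = Z0 := by simp [hZf]
  rw [← hBZ x hx, hZ00] at c1
  rw [hEn]
  rw [sub_eq_iff_eq_add] at c1
  exact c1

theorem duhamel {Q : ℝ → M2} {l : ℂ} {c : ℝ → Fin 2 → ℂ} (h : IsVecSolution Q l c) :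
    (∃ M : ℝ, 0 < M ∧ ∀ x ∈ Icc (0:ℝ) 1, ‖iot (c x)‖ ≤ M) ∧
    AEStronglyMeasurable (fun s => iot (c s)) μ01 ∧
    ∀ x ∈ Icc (0:ℝ) 1,
      IntegrableOn (fun s => EE l (x - s) * ((Bmat * Q s) * iot (c s))) (Ioo 0 x) ∧
      iot (c x) = EE l x * iot (c 0) + ∫ s in Ioo 0 x, EE l (x - s) * ((Bmat * Q s) * iot (c s)) := by
  obtain ⟨u', hu', hu, hode⟩ := h
  have hu'i : IntervalIntegrable u' volume 0 1 := by
    rw [intervalIntegrable_iff_integrableOn_Ioo_of_le zero_le_one]; exact hu'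
  set z : ℝ → M2 := fun s => iot (u' s) with hz
  have hzi : IntervalIntegrable z volume 0 1 := by
    rw [intervalIntegrable_iff_integrableOn_Ioo_of_le zero_le_one]
    exact iot.integrable_comp hu'
  have hZ : ∀ x ∈ Icc (0:ℝ) 1, iot (c x) = iot (c 0) + ∫ t in (0:ℝ)..x, z t := by
    intro x hx
    rw [hu x hx, map_add]
    congr 1
    have : IntervalIntegrable u' volume 0 x := hu'i.mono_set (by
      rw [uIcc_of_le hx.1, uIcc_of_le zero_le_one]; exact Icc_subset_Icc_right hx.2)
    exact (ContinuousLinearMap.intervalIntegral_comp_comm iot this).symm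
  obtain ⟨hGi, hG⟩ := duh1 l (iot (c 0)) hzi
  have hcont : ContinuousOn (fun x => iot (c x)) (Icc 0 1) := by
    have h1 : ContinuousOn (fun x => ∫ t in (0:ℝ)..x, z t) (Icc 0 1) := by
      have := (ac_int hzi).continuousOn
      simpa using this
    exact (continuousOn_const.add h1).congr hZ
  refine ⟨?_, ?_, ?_⟩
  · obtain ⟨C, hC⟩ := isCompact_Icc.exists_bound_of_continuousOn hcont
    exact ⟨|C| + 1, by positivity, fun τ h => by linarith [hC τ h, le_abs_self C]⟩
  · exact (hcont.mono Ioo_subset_Icc_self).aestronglyMeasurable measurableSet_Ioo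
  intro x hx
  set G : ℝ → M2 := fun s => EE l (-s) * (z s + l • (Bmat * (iot (c 0) + ∫ t in (0:ℝ)..s, z t))) with hGd
  have hGae : ∀ᵐ s ∂(volume.restrict (Ioo 0 x)), EE l x * G s = EE l (x - s) * ((Bmat * Q s) * iot (c s)) := by
    have h1 : ∀ᵐ s ∂(volume.restrict (Ioo 0 x)), Bmat.mulVec (u' s) + (Q s).mulVec (c s) = l • c s :=
      ae_mono (Measure.restrict_mono (Ioo_subset_Ioo_right hx.2) le_rfl) hode
    filter_upwards [h1, ae_restrict_mem measurableSet_Ioo] with s hs hsI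
    have h2 := congrArg iot hs
    rw [map_add, iot_mulVec, iot_mulVec, map_smul] at h2
    have h3 := congrArg (fun A => Bmat * A) h2
    simp only [mul_add, ← mul_assoc, Bsq, neg_mul, one_mul, mul_smul_comm] at h3
    rw [hGd]
    simp only
    rw [← hZ s ⟨hsI.1.le, hsI.2.le.trans hx.2⟩, ← mul_assoc, ← EE_add, ← sub_eq_add_neg]
    congr 1
    rw [← h3, hz]
    simp
  have hGix : IntegrableOn G (Ioo 0 x) := by
    have := (intervalIntegrable_iff_integrableOn_Ioo_of_le zero_le_one).1 hGi
    exact this.mono_set (Ioo_subset_Ioo_right hx.2)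
  refine ⟨Integrable.congr (hGix.const_mul (EE l x)) hGae, ?_⟩
  rw [← integral_congr_ae hGae, integral_const_mul_of_integrable hGix, ← mul_add]
  have := hG x hx
  have e : intervalIntegral G 0 x volume = ∫ s in Ioo 0 x, G s := by
    rw [intervalIntegral.integral_of_le hx.1, integral_Ioc_eq_integral_Ioo]
  rw [e] at this
  rw [← this, ← mul_assoc, ← EE_add, add_neg_cancel, EE_zero, one_mul]
  exact hZ x hx

end duh

section repr

theorem int_supp {f : ℝ → M2} (hm : AEStronglyMeasurable f volume) {C : ℝ}
    (hb : ∀ t ∈ Ioo (-1:ℝ) 1, ‖f t‖ ≤ C) (hs : ∀ t, 1 ≤ |t| → f t = 0) :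
    Integrable f ∧ ‖∫ t, f t‖ ≤ C * 2 := by
  have hz : ∀ t, t ∉ Ioo (-1:ℝ) 1 → f t = 0 := by
    intro t ht
    refine hs t ?_
    by_contra hh
    have := abs_lt.1 (not_le.1 hh)
    exact ht this
  have h1 : IntegrableOn f (Ioo (-1:ℝ) 1) := by
    refine Measure.integrableOn_of_bounded (M := C) (by simp) hm ?_
    filter_upwards [ae_restrict_mem measurableSet_Ioo] with s hs using hb s hs
  constructor
  · rw [← integrableOn_iff_integrable_of_support_subset (s := Ioo (-1:ℝ) 1)]
    · exact h1
    · intro t ht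
      by_contra hh
      exact ht (hz t hh)
  · rw [← setIntegral_eq_integral_of_forall_compl_eq_zero (s := Ioo (-1:ℝ) 1) hz]
    have := norm_setIntegral_le_of_norm_le_const (μ := volume) (s := Ioo (-1:ℝ) 1) (by simp) hb
    refine this.trans_eq ?_
    simp [measureReal_def]; norm_num

/-- the fundamental matrix built from the kernel -/
def UU (l : ℂ) (w : ℝ → M2) (x : ℝ) : M2 := EE l x + ∫ t, EE l t * kS w x t

theorem UU_int (l : ℂ) {w : ℝ → M2} (hw : BC w) :
    ∃ C : ℝ, ∀ x ∈ Icc (0:ℝ) 1, Integrable (fun t => EE l t * kS w x t) ∧ ‖∫ t, EE l t * kS w x t‖ ≤ C := by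
  obtain ⟨A, hA, hAb⟩ := EE_bound l
  obtain ⟨C, hC⟩ := hw.bound 1
  refine ⟨A * C * 2, fun x hx => int_supp ?_ ?_ ?_⟩
  · have h1 : StronglyMeasurable (kS w x) :=
      hw.meas.comp_measurable (g := fun t : ℝ => (x, t)) (by fun_prop)
    exact ((EE_cont l).stronglyMeasurable.mul h1).aestronglyMeasurable
  · intro t ht
    exact (norm_mul_le _ _).trans (mul_le_mul (hAb t ⟨ht.1.le, ht.2.le⟩) (hC x hx.2 t) (norm_nonneg _) hA.le)
  · intro t ht
    rw [kS_supp w x t (hx.2.trans ht), mul_zero]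

theorem part_G (l : ℂ) {w : ℝ → M2} (hw : Nice w) {x : ℝ} :
    ∫ t, EE l t * kG w x t = ∫ s in Ioo 0 x, EE l (x - s) * (w s * EE l s) := by
  have h1 : ∫ s : ℝ, EE l (x - 2 * s) * kG w x (x - 2 * s) = (2⁻¹ : ℝ) • ∫ t, EE l t * kG w x t := by
    have a := Measure.integral_comp_mul_left (fun u => EE l (x - u) * kG w x (x - u)) (2:ℝ)
    rw [integral_sub_left_eq_self (fun t => EE l t * kG w x t) volume x] at a
    rw [a]; norm_num
  have h2 : ∫ s : ℝ, EE l (x - 2 * s) * kG w x (x - 2 * s) =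
      (2⁻¹ : ℝ) • ∫ s in Ioo 0 x, EE l (x - s) * (w s * EE l s) := by
    rw [← integral_smul, ← integral_indicator measurableSet_Ioo]
    congr 1
    funext s
    by_cases hs : s ∈ Ioo 0 x
    · rw [indicator_of_mem hs]
      have : |x - 2 * s| < x := abs_lt.2 ⟨by linarith [hs.2], by linarith [hs.1]⟩
      rw [EE_anti l s (hw.2 s), ← mul_assoc, ← EE_add]
      simp only [kG, if_pos this]
      rw [mul_smul_comm, show (x - (x - 2 * s)) / 2 = s by ring, show x - s + -s = x - 2 * s by ring]
      norm_num
    · rw [indicator_of_notMem hs]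
      have : ¬ |x - 2 * s| < x := by
        intro h
        have := abs_lt.1 h
        exact hs ⟨by linarith [this.2], by linarith [this.1]⟩
      simp only [kG, if_neg this, mul_zero]
  rw [h1] at h2
  exact smul_right_injective M2 (by norm_num : (2⁻¹ : ℝ) ≠ 0) h2

theorem part_T_int (l : ℂ) {w : ℝ → M2} (hw : Nice w) {x : ℝ} (hx : x ∈ Icc (0:ℝ) 1) :
    Integrable (Function.uncurry fun t s => EE l t * (w s * kS w s (x - s - t)))
      (volume.prod (volume.restrict (Ioo 0 x))) := by
  obtain ⟨A, hA, hAb⟩ := EE_bound l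
  obtain ⟨C, hC⟩ := hw.1.bound 1
  obtain ⟨M, hM, hMb⟩ := hw.1.2
  have hm : StronglyMeasurable (Function.uncurry fun t s => EE l t * (w s * kS w s (x - s - t))) := by
    have h1 : StronglyMeasurable fun z : ℝ × ℝ => kS w z.2 (x - z.2 - z.1) :=
      hw.1.meas.comp_measurable (g := fun z : ℝ × ℝ => (z.2, x - z.2 - z.1)) (by fun_prop)
    exact ((EE_cont l).stronglyMeasurable.comp_measurable measurable_fst).mul
      ((hw.1.1.stronglyMeasurable.comp_measurable measurable_snd).mul h1)
  have hg : Integrable (((Ioo (-1:ℝ) 1) ×ˢ univ).indicator fun _ : ℝ × ℝ => A * (M * C))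
      (volume.prod (volume.restrict (Ioo 0 x))) := by
    rw [integrable_indicator_iff (measurableSet_Ioo.prod MeasurableSet.univ)]
    refine integrableOn_const ?_
    rw [Measure.prod_prod]
    simp only [Measure.restrict_apply_univ, Real.volume_Ioo]
    exact ENNReal.mul_ne_top (by simp) (by simp)
  refine hg.mono' hm.aestronglyMeasurable ?_
  have hmem : ∀ᵐ z ∂(volume.prod (volume.restrict (Ioo 0 x)) : Measure (ℝ × ℝ)), z.2 ∈ Ioo 0 x :=
    Measure.quasiMeasurePreserving_snd.ae (ae_restrict_mem measurableSet_Ioo)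
  filter_upwards [hmem] with z hz
  obtain ⟨t, s⟩ := z
  simp only at hz
  have hs1 : s ≤ 1 := hz.2.le.trans hx.2
  by_cases ht : t ∈ Ioo (-1:ℝ) 1
  · rw [indicator_of_mem (by simpa using ht)]
    refine (norm_mul_le _ _).trans (mul_le_mul (hAb t ⟨ht.1.le, ht.2.le⟩) ?_ (norm_nonneg _) hA.le)
    exact (norm_mul_le _ _).trans (mul_le_mul (hMb s) (hC s hs1 _) (norm_nonneg _) hM.le)
  · rw [indicator_of_notMem (by simpa using ht)]
    have : kS w s (x - s - t) = 0 := by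
      apply kS_supp
      by_contra hh
      have := abs_lt.1 (not_le.1 hh)
      exact ht ⟨by linarith [this.2, hz.2, hx.1, hz.1, hx.2], by linarith [this.1, hz.1, hx.2]⟩
    simp [this]

theorem part_T (l : ℂ) {w : ℝ → M2} (hw : Nice w) {x : ℝ} (hx : x ∈ Icc (0:ℝ) 1) :
    IntegrableOn (fun s => EE l (x - s) * (w s * ∫ t, EE l t * kS w s t)) (Ioo 0 x) ∧
    ∫ t, EE l t * kT w (kS w) x t = ∫ s in Ioo 0 x, EE l (x - s) * (w s * ∫ t, EE l t * kS w s t) := by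
  have hI := part_T_int l hw hx
  obtain ⟨C, hC⟩ := UU_int l hw.1
  have hin : ∀ s ∈ Ioo 0 x, ∫ t, EE l t * (w s * kS w s (x - s - t)) =
      EE l (x - s) * (w s * ∫ t, EE l t * kS w s t) := by
    intro s hs
    have h1 := integral_sub_left_eq_self (fun τ => EE l (x - s - τ) * (w s * kS w s τ)) volume (x - s)
    simp only [sub_sub_cancel] at h1
    rw [h1]
    have h2 : ∀ τ, EE l (x - s - τ) * (w s * kS w s τ) = EE l (x - s) * (w s * (EE l τ * kS w s τ)) := by
      intro τ
      rw [sub_eq_add_neg (x - s) τ, EE_add, ← mul_assoc (w s), EE_anti l τ (hw.2 s)]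
      simp only [mul_assoc]
    simp_rw [h2]
    have hi := (hC s ⟨hs.1.le, hs.2.le.trans hx.2⟩).1
    rw [integral_const_mul_of_integrable (hi.const_mul (w s)), integral_const_mul_of_integrable hi]
  have hae : ∀ᵐ s ∂(volume.restrict (Ioo 0 x)), ∫ t, EE l t * (w s * kS w s (x - s - t)) =
      EE l (x - s) * (w s * ∫ t, EE l t * kS w s t) := by
    filter_upwards [ae_restrict_mem measurableSet_Ioo] with s hs using hin s hs
  constructor
  · exact Integrable.congr hI.integral_prod_right hae
  · rw [← integral_congr_ae hae, ← integral_integral_swap hI]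
    congr 1
    funext t
    rw [kT, integral_const_mul_of_integrable (kT_integrable hw.1 hw.1.meas hw.1.bound x t)]

theorem UU_eq (l : ℂ) {w : ℝ → M2} (hw : Nice w) {x : ℝ} (hx : x ∈ Icc (0:ℝ) 1) :
    IntegrableOn (fun s => EE l (x - s) * (w s * UU l w s)) (Ioo 0 x) ∧
    UU l w x = EE l x + ∫ s in Ioo 0 x, EE l (x - s) * (w s * UU l w s) := by
  obtain ⟨hT, hTe⟩ := part_T l hw hx
  have hGc : Continuous fun s => EE l (x - s) * (w s * EE l s) :=
    ((EE_cont l).comp (continuous_const.sub continuous_id)).mul (hw.1.1.mul (EE_cont l))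
  have hG : IntegrableOn (fun s => EE l (x - s) * (w s * EE l s)) (Ioo 0 x) :=
    (hGc.integrableOn_Icc (a := 0) (b := x)).mono_set Ioo_subset_Icc_self
  have e : ∀ s, EE l (x - s) * (w s * UU l w s) = EE l (x - s) * (w s * EE l s) +
      EE l (x - s) * (w s * ∫ t, EE l t * kS w s t) := by
    intro s; rw [UU, mul_add, mul_add]
  simp_rw [e]
  refine ⟨hG.add hT, ?_⟩
  rw [integral_add hG hT, ← part_G l hw, ← hTe]
  obtain ⟨C, hC⟩ := UU_int l hw.1
  have hi := (hC x hx).1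
  have hgi : Integrable fun t => EE l t * kG w x t := by
    obtain ⟨A, hA, hAb⟩ := EE_bound l
    obtain ⟨M, hM, hMb⟩ := hw.1.2
    have h1 : StronglyMeasurable (kG w x) :=
      (kG_meas hw.1.1).comp_measurable (g := fun t : ℝ => (x, t)) (by fun_prop)
    refine (int_supp (C := A * M) ((EE_cont l).stronglyMeasurable.mul h1).aestronglyMeasurable ?_ ?_).1
    · intro t ht
      refine (norm_mul_le _ _).trans (mul_le_mul (hAb t ⟨ht.1.le, ht.2.le⟩) ?_ (norm_nonneg _) hA.le)
      unfold kG
      split_ifs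
      · rw [norm_smul]
        have := hMb ((x - t) / 2)
        have h0 := norm_nonneg (w ((x - t) / 2))
        norm_num; linarith
      · simpa using hM.le
    · intro t ht
      rw [Pi.mul_apply, kG_supp w (hx.2.trans ht), mul_zero]
  have hti : Integrable fun t => EE l t * kT w (kS w) x t := by
    refine (hi.sub hgi).congr (Eventually.of_forall fun t => ?_)
    simp only [Pi.sub_apply]
    rw [hw.1.eq x t, mul_add]; abel
  rw [UU, ← integral_add hgi hti]
  congr 2
  funext t
  rw [← mul_add, ← hw.1.eq x t]

theorem pt_id (l : ℂ) (t : ℝ) (A A' : M2) :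
    (EE l t * A + EE l (-t) * A') * iot ![1, 0] = (mvL A + mvL A' * Jmat) * iot (c0 l t) := by
  ext i j; fin_cases i <;> fin_cases j <;>
    simp [EE, expB, mvL_apply, iot_apply, c0, Jmat, Matrix.mul_apply, Matrix.vecMul, dotProduct, Fin.sum_univ_two] <;> ring

theorem UU_rep (l : ℂ) {w : ℝ → M2} (hw : BC w) {x : ℝ} (hx : x ∈ Icc (0:ℝ) 1) :
    UU l w x * iot ![1, 0] = iot (c0 l x) + ∫ t in Ioo 0 x, kK w x t * iot (c0 l t) := by
  obtain ⟨C, hC⟩ := UU_int l hw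
  have hi := (hC x hx).1
  have hin : Integrable fun t => EE l (-t) * kS w x (-t) := hi.comp_neg
  have h1 : ∫ t, EE l t * kS w x t = ∫ t in Ioo 0 x, (EE l t * kS w x t + EE l (-t) * kS w x (-t)) := by
    rw [integral_add hi.integrableOn hin.integrableOn]
    have a := intervalIntegral.integral_Iic_add_Ioi (b := (0:ℝ)) (μ := volume)
      hi.integrableOn hi.integrableOn
    have b := integral_comp_neg_Ioi (0:ℝ) (fun t => EE l t * kS w x t)
    rw [neg_zero] at b
    rw [← a, ← b, add_comm]
    have hsub : Ioo 0 x ⊆ Ioi 0 := fun t ht => ht.1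
    have hx0 : ∀ t ∈ Ioi (0:ℝ) \ Ioo 0 x, x ≤ |t| := by
      intro t ht
      rw [abs_of_pos ht.1]
      by_contra hh
      exact ht.2 ⟨ht.1, not_le.1 hh⟩
    congr 1
    · refine setIntegral_eq_of_subset_of_forall_sdiff_eq_zero measurableSet_Ioi hsub fun t ht => ?_
      rw [kS_supp w x t (hx0 t ht), mul_zero]
    · refine setIntegral_eq_of_subset_of_forall_sdiff_eq_zero measurableSet_Ioi hsub fun t ht => ?_
      rw [kS_supp w x (-t) (by rw [abs_neg]; exact hx0 t ht), mul_zero]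
  have hsum : IntegrableOn (fun t => EE l t * kS w x t + EE l (-t) * kS w x (-t)) (Ioo 0 x) :=
    (hi.add hin).integrableOn
  rw [UU, h1, add_mul, ← integral_mul_const_of_integrable hsum]
  congr 1
  · ext i j; fin_cases i <;> fin_cases j <;> simp [EE, expB, iot_apply, c0, Matrix.mul_apply]
  · refine setIntegral_congr_fun measurableSet_Ioo fun t ht => ?_
    rw [pt_id, kK, if_pos ⟨ht.1.le, ht.2.le, hx.2⟩]

end repr

section compar

instance prob01 : IsProbabilityMeasure μ01 := ⟨by simp [μ01]⟩

theorem eLp_one_le {p : ℝ≥0∞} (hp : 1 ≤ p) {f : ℝ → M2} (hf : AEStronglyMeasurable f μ01) :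
    ∫⁻ s in Ioo 0 1, ‖f s‖ₑ ≤ eLpNorm f p μ01 := by
  have := eLpNorm_le_eLpNorm_of_exponent_le hp hf
  rwa [eLpNorm_one_eq_lintegral_enorm] at this

theorem compare {Q : ℝ → M2} {l : ℂ} {c : ℝ → Fin 2 → ℂ} (hs : IsVecSolution Q l c)
    (hc : c 0 = ![1, 0]) {p : ℝ≥0∞} (hp : 1 ≤ p) (hp' : p ≠ ∞)
    (hW : MemLp (fun s => Bmat * Q s) p μ01)
    (ha : ∀ s, Bmat * (Bmat * Q s) = -((Bmat * Q s) * Bmat)) :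
    ∃ η C : ℝ≥0∞, η ≠ 0 ∧ C ≠ ∞ ∧ ∀ h : ℝ → M2, Nice h →
      eLpNorm (fun s => Bmat * Q s - h s) p μ01 ≤ η → ∀ x ∈ Icc (0:ℝ) 1,
      ‖iot (c x) - UU l h x * iot ![1, 0]‖ₑ ≤ C * eLpNorm (fun s => Bmat * Q s - h s) p μ01 := by
  obtain ⟨A, hA, hAb⟩ := EE_bound l
  obtain ⟨⟨M, hM, hMb⟩, hmeas, hduh⟩ := duhamel hs
  rw [hc] at hduh
  obtain ⟨η, hη, hηt, hmod⟩ := modulus (R := M2) (q := 1) le_rfl (C := ENNReal.ofReal A) ENNReal.ofReal_ne_top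
  have hη2 : η / 2 ≠ 0 := by simp [hη]
  obtain ⟨h0, hh0, hd0⟩ := nice_dense hp' hW ha hη2
  obtain ⟨M0, hM0, hM0b⟩ := hh0.1.2
  obtain ⟨k, hk0, hk⟩ := hmod M0
  refine ⟨η / 2, 2 * (ENNReal.ofReal A * ENNReal.ofReal M) * ENNReal.ofReal (Real.exp k), hη2, by finiteness, ?_⟩
  intro h hh hd
  have hm : AEStronglyMeasurable (fun s => Bmat * Q s - h s) μ01 := hW.1.sub (hh.1.memLp p).1
  have hn : nq 1 (fun s => h s - h0 s) ≤ η := by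
    have e : nq 1 (fun s => h s - h0 s) = ∫⁻ s in Ioo 0 1, ‖h s - h0 s‖ₑ := by simp [nq]
    rw [e]
    refine (eLp_one_le hp ((hh.1.memLp p).1.sub (hh0.1.memLp p).1)).trans ?_
    refine (eLp_tri hp (hh.1.memLp p).1 hW.1 (hh0.1.memLp p).1).trans ?_
    rw [eLp_comm h]
    calc _ ≤ η / 2 + η / 2 := add_le_add hd hd0
      _ = η := ENNReal.add_halves η
  have hkk := hk h h0 hh.1.1 hh0.1.1 hM0b hn
  simp only [ENNReal.rpow_one] at hkk
  set P := iot ![1, 0] with hP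
  obtain ⟨C1, hC1⟩ := UU_int l hh.1
  have hbdd : ∀ x ∈ Icc (0:ℝ) 1, ‖iot (c x) - UU l h x * P‖ₑ ≤ ENNReal.ofReal (M + (A + C1) * ‖P‖) := by
    intro x hx
    rw [← ofReal_norm]
    refine ENNReal.ofReal_le_ofReal ((norm_sub_le _ _).trans (add_le_add (hMb x hx) ((norm_mul_le _ _).trans
      (mul_le_mul_of_nonneg_right ((norm_add_le _ _).trans (add_le_add (hAb x ⟨by linarith [hx.1], hx.2⟩) (hC1 x hx).2)) (norm_nonneg _)))))
  have hmain : ∀ x ∈ Icc (0:ℝ) 1, ‖iot (c x) - UU l h x * P‖ₑ ≤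
      ENNReal.ofReal A * ENNReal.ofReal M * eLpNorm (fun s => Bmat * Q s - h s) p μ01 +
      ENNReal.ofReal A * ∫⁻ s in Ioo 0 x, ‖h s‖ₑ * ‖iot (c s) - UU l h s * P‖ₑ := by
    intro x hx
    obtain ⟨i1, e1⟩ := hduh x hx
    obtain ⟨i2, e2⟩ := UU_eq l hh hx
    have hsub : Ioo 0 x ⊆ Ioo (0:ℝ) 1 := Ioo_subset_Ioo_right hx.2
    have i3 : IntegrableOn (fun s => EE l (x - s) * (h s * UU l h s) * P) (Ioo 0 x) := i2.mul_const P
    have e3 : iot (c x) - UU l h x * P = ∫ s in Ioo 0 x, (EE l (x - s) * ((Bmat * Q s) * iot (c s)) -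
        EE l (x - s) * (h s * UU l h s) * P) := by
      rw [integral_sub i1 i3, e1, e2, add_mul, integral_mul_const_of_integrable i2]
      abel
    rw [e3]
    refine (enorm_integral_le_lintegral_enorm _).trans ?_
    have hpt : ∀ s ∈ Ioo 0 x, ‖EE l (x - s) * ((Bmat * Q s) * iot (c s)) - EE l (x - s) * (h s * UU l h s) * P‖ₑ ≤
        ENNReal.ofReal A * ENNReal.ofReal M * ‖Bmat * Q s - h s‖ₑ +
          ENNReal.ofReal A * (‖h s‖ₑ * ‖iot (c s) - UU l h s * P‖ₑ) := by
      intro s hs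
      have e : EE l (x - s) * ((Bmat * Q s) * iot (c s)) - EE l (x - s) * (h s * UU l h s) * P =
        EE l (x - s) * ((Bmat * Q s - h s) * iot (c s) + h s * (iot (c s) - UU l h s * P)) := by noncomm_ring
      have hE : ‖EE l (x - s)‖ₑ ≤ ENNReal.ofReal A := by
        rw [← ofReal_norm]
        exact ENNReal.ofReal_le_ofReal (hAb _ ⟨by linarith [hs.2], by linarith [hs.1, hx.2]⟩)
      have hZ : ‖iot (c s)‖ₑ ≤ ENNReal.ofReal M := by
        rw [← ofReal_norm]
        exact ENNReal.ofReal_le_ofReal (hMb _ ⟨hs.1.le, hs.2.le.trans hx.2⟩)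
      rw [e]
      calc _ ≤ ENNReal.ofReal A * (‖Bmat * Q s - h s‖ₑ * ENNReal.ofReal M + ‖h s‖ₑ * ‖iot (c s) - UU l h s * P‖ₑ) := by
            refine (enorm_ring_mul_le _ _).trans (mul_le_mul' hE ((enorm_add_le _ _).trans (add_le_add ?_ (enorm_ring_mul_le _ _))))
            exact (enorm_ring_mul_le _ _).trans (mul_le_mul' le_rfl hZ)
        _ = _ := by ring
    refine (setLIntegral_mono' measurableSet_Ioo hpt).trans ?_
    have hm' : AEMeasurable (fun s => ENNReal.ofReal A * ENNReal.ofReal M * ‖Bmat * Q s - h s‖ₑ) (volume.restrict (Ioo 0 x)) :=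
      (hm.mono_measure (Measure.restrict_mono hsub le_rfl)).enorm.const_mul _
    rw [lintegral_add_left' hm', lintegral_const_mul' _ _ (by finiteness), lintegral_const_mul' _ _ (by finiteness)]
    gcongr
    exact (lintegral_mono_set hsub).trans (eLp_one_le hp hm)
  intro x hx
  have := gron hk0 ENNReal.ofReal_ne_top hbdd hmain hkk x hx
  refine this.trans (le_of_eq ?_)
  ring

end compar

section final

theorem iot_c0 (l : ℂ) (t : ℝ) : iot (c0 l t) = EE l t * iot ![1, 0] := by
  ext i j; fin_cases i <;> fin_cases j <;> simp [EE, expB, iot_apply, c0, Matrix.mul_apply]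

theorem iot_c0_cont (l : ℂ) : Continuous fun t => iot (c0 l t) := by
  simp_rw [iot_c0]
  exact (EE_cont l).mul continuous_const

theorem iot_c0_bound (l : ℂ) : ∃ C : ℝ, 0 < C ∧ ∀ t ∈ Icc (0:ℝ) 1, ‖iot (c0 l t)‖ ≤ C := by
  obtain ⟨A, hA, hAb⟩ := EE_bound l
  refine ⟨A * (‖iot ![1, 0]‖ + 1), by positivity, fun t ht => ?_⟩
  rw [iot_c0]
  exact (norm_mul_le _ _).trans (mul_le_mul (hAb t ⟨by linarith [ht.1], ht.2⟩) (by linarith) (norm_nonneg _) hA.le)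

theorem row_int (l : ℂ) {p : ℝ≥0∞} (hp : 1 ≤ p) {f : ℝ → M2} (hf : MemLp f p μ01) {x : ℝ} (hx : x ∈ Icc (0:ℝ) 1) :
    IntegrableOn (fun t => f t * iot (c0 l t)) (Ioo 0 x) := by
  obtain ⟨C, hC, hb⟩ := iot_c0_bound l
  have h1 : IntegrableOn f (Ioo 0 1) := hf.integrable hp
  have h2 : IntegrableOn f (Ioo 0 x) := h1.mono_set (Ioo_subset_Ioo_right hx.2)
  refine Integrable.mono' (h2.norm.mul_const C)
    (h2.1.mul (iot_c0_cont l).aestronglyMeasurable) ?_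
  filter_upwards [ae_restrict_mem measurableSet_Ioo] with t ht
  exact (norm_mul_le _ _).trans (mul_le_mul_of_nonneg_left (hb t ⟨ht.1.le, ht.2.le.trans hx.2⟩) (norm_nonneg _))

theorem row_bound (l : ℂ) : ∃ C : ℝ≥0∞, C ≠ ∞ ∧ ∀ {p : ℝ≥0∞}, 1 ≤ p → ∀ {f : ℝ → M2}, MemLp f p μ01 →
    ∀ x ∈ Icc (0:ℝ) 1, ‖∫ t in Ioo 0 x, f t * iot (c0 l t)‖ₑ ≤ C * eLpNorm f p μ01 := by
  obtain ⟨C, hC, hb⟩ := iot_c0_bound l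
  refine ⟨ENNReal.ofReal C, ENNReal.ofReal_ne_top, fun {p} hp {f} hf x hx => ?_⟩
  refine (enorm_integral_le_lintegral_enorm _).trans ?_
  calc _ ≤ ∫⁻ t in Ioo 0 x, ENNReal.ofReal C * ‖f t‖ₑ := by
        refine setLIntegral_mono' measurableSet_Ioo fun t ht => ?_
        rw [mul_comm]
        refine (enorm_ring_mul_le _ _).trans (mul_le_mul' le_rfl ?_)
        rw [← ofReal_norm]
        exact ENNReal.ofReal_le_ofReal (hb t ⟨ht.1.le, ht.2.le.trans hx.2⟩)
    _ ≤ _ := by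
        rw [lintegral_const_mul' _ _ ENNReal.ofReal_ne_top]
        gcongr
        exact (lintegral_mono_set (Ioo_subset_Ioo_right hx.2)).trans (eLp_one_le hp hf.1)

theorem transf {p : ℝ≥0∞} (hp : 1 ≤ p) (hp' : p ≠ ∞) {Q : ℝ → M2}
    (hW : MemLp (fun s => Bmat * Q s) p μ01)
    (ha : ∀ s, Bmat * (Bmat * Q s) = -((Bmat * Q s) * Bmat)) {K : ℝ → ℝ → M2} (hK : MemGp p K)
    (hsupp : ∀ x t : ℝ, ¬ (0 ≤ t ∧ t ≤ x ∧ x ≤ 1) → K x t = 0)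
    (hlim : ∃ η L : ℝ≥0∞, η ≠ 0 ∧ L ≠ ∞ ∧ ∀ h, Nice h → eLpNorm (fun s => Bmat * Q s - h s) p μ01 ≤ η →
        gpNorm p (fun x t => K x t - kK h x t) ≤ L * eLpNorm (fun s => Bmat * Q s - h s) p μ01) :
    IsTransfKernel Q K := by
  refine ⟨hsupp, fun l c hs hc x hx => ?_⟩
  obtain ⟨η, L, hη, hL, H⟩ := hlim
  obtain ⟨η', C, hη', hC, H'⟩ := compare hs hc hp hp' hW ha
  obtain ⟨R, hR, HR⟩ := row_bound l
  have hi := row_int l hp (hK.1 x hx) hx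
  have key : ∀ ε : ℝ≥0∞, ε ≠ 0 → ε ≤ η → ε ≤ η' →
      ‖iot (c x) - (iot (c0 l x) + ∫ t in Ioo 0 x, K x t * iot (c0 l t))‖ₑ ≤ (C + R * L) * ε := by
    intro ε h0 h1 h2
    obtain ⟨h, hh, hd⟩ := nice_dense hp' hW ha h0
    have hkm := (kK_memGp hp hp' hh.1).1 x hx
    have e : iot (c x) - (iot (c0 l x) + ∫ t in Ioo 0 x, K x t * iot (c0 l t)) =
        (iot (c x) - UU l h x * iot ![1, 0]) - ∫ t in Ioo 0 x, (K x t - kK h x t) * iot (c0 l t) := by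
      simp_rw [sub_mul]
      rw [integral_sub hi (row_int l hp hkm hx), UU_rep l hh.1 hx]
      abel
    rw [e, add_mul, mul_assoc]
    refine enorm_sub_le.trans (add_le_add ?_ ?_)
    · exact (H' h hh (hd.trans h2) x hx).trans (mul_le_mul' le_rfl hd)
    · refine (HR hp ((hK.1 x hx).sub hkm) x hx).trans (mul_le_mul' le_rfl ?_)
      refine (row_le_gp p (fun x t => K x t - kK h x t) hx).trans ?_
      exact (H h hh (hd.trans h1)).trans (mul_le_mul' le_rfl hd)
  have hz : ‖iot (c x) - (iot (c0 l x) + ∫ t in Ioo 0 x, K x t * iot (c0 l t))‖ₑ = 0 := by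
    have hD : C + R * L ≠ ∞ := by finiteness
    have ht : Tendsto (fun ε : ℝ≥0∞ => (C + R * L) * ε) (𝓝[≠] 0) (𝓝 ((C + R * L) * 0)) :=
      (ENNReal.Tendsto.const_mul tendsto_id (Or.inr hD)).mono_left nhdsWithin_le_nhds
    rw [mul_zero] at ht
    refine le_antisymm (ge_of_tendsto ht ?_) zero_le
    have hm : Iio (min η η') ∈ 𝓝 (0:ℝ≥0∞) :=
      Iio_mem_nhds (lt_min (pos_iff_ne_zero.2 hη) (pos_iff_ne_zero.2 hη'))
    filter_upwards [self_mem_nhdsWithin, nhdsWithin_le_nhds hm] with ε h0 h1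
    exact key ε h0 (h1.le.trans (min_le_left _ _)) (h1.le.trans (min_le_right _ _))
  rw [enorm_eq_zero, sub_eq_zero] at hz
  have := congrArg col0 hz
  rw [map_add, col0_iot, col0_iot, ← ContinuousLinearMap.integral_comp_comm _ hi] at this
  rw [this, intervalIntegral.integral_of_le hx.1, integral_Ioc_eq_integral_Ioo]
  simp_rw [← iot_mulVec, col0_iot]

theorem dirac_anti {Q : ℝ → M2} (hQ : IsDiracForm Q) (s : ℝ) :
    Bmat * (Bmat * Q s) = -((Bmat * Q s) * Bmat) := by
  obtain ⟨q1, q2, h⟩ := hQ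
  rw [h]
  ext i j; fin_cases i <;> fin_cases j <;> simp [Bmat]

theorem BQ_mem {p : ℝ≥0∞} {Q : ℝ → M2} (hQ : MemLp Q p μ01) : MemLp (fun s => Bmat * Q s) p μ01 :=
  hQ.of_le_mul (c := ‖Bmat‖) (hQ.1.const_mul Bmat) (Eventually.of_forall fun s => norm_mul_le _ _)

theorem BQ_sub (p : ℝ≥0∞) (Q Q' : ℝ → M2) :
    eLpNorm (fun s => Bmat * Q s - Bmat * Q' s) p μ01 ≤
      ENNReal.ofReal ‖Bmat‖ * eLpNorm (fun s => Q s - Q' s) p μ01 := by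
  refine eLpNorm_le_mul_eLpNorm_of_ae_le_mul (Eventually.of_forall fun s => ?_) p
  rw [← mul_sub]; exact norm_mul_le _ _

def Good (p : ℝ≥0∞) (Q : ℝ → M2) (K : ℝ → ℝ → M2) : Prop :=
  MemGp p K ∧ (∀ x t : ℝ, ¬ (0 ≤ t ∧ t ≤ x ∧ x ≤ 1) → K x t = 0) ∧
      ∃ η L : ℝ≥0∞, η ≠ 0 ∧ L ≠ ∞ ∧ ∀ h, Nice h → eLpNorm (fun s => Bmat * Q s - h s) p μ01 ≤ η →
        gpNorm p (fun x t => K x t - kK h x t) ≤ L * eLpNorm (fun s => Bmat * Q s - h s) p μ01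

theorem good_cont {p : ℝ≥0∞} (hp : 1 ≤ p) (hp' : p ≠ ∞) {Q : ℝ → M2} (hQ : MemLp Q p μ01)
    {K : ℝ → ℝ → M2} (hK : Good p Q K) {ε : ℝ} (hε : 0 < ε) :
    ∃ δ > (0:ℝ), ∀ Q' : ℝ → M2, IsDiracForm Q' → MemLp Q' p μ01 → ∀ K', Good p Q' K' →
          eLpNorm (fun x => Q x - Q' x) p μ01 < ENNReal.ofReal δ →
          gpNorm p (fun x t => K x t - K' x t) < ENNReal.ofReal ε := by
  obtain ⟨hG, -, η, L, hη, hL, H⟩ := hK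
  set b : ℝ≥0∞ := ENNReal.ofReal ‖Bmat‖ with hb
  have hbt : b ≠ ∞ := ENNReal.ofReal_ne_top
  set e : ℝ≥0∞ := ENNReal.ofReal ε with he
  have he0 : e ≠ 0 := by simp [he, hε]
  have small : ∀ D a : ℝ≥0∞, D ≠ ∞ → a ≠ 0 → ∀ᶠ τ in 𝓝[≠] (0:ℝ≥0∞), D * τ < a := by
    intro D a hD h0
    have ht : Tendsto (fun τ : ℝ≥0∞ => D * τ) (𝓝[≠] 0) (𝓝 (D * 0)) :=
      (ENNReal.Tendsto.const_mul tendsto_id (Or.inr hD)).mono_left nhdsWithin_le_nhds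
    rw [mul_zero] at ht
    exact ht.eventually (Iio_mem_nhds (pos_iff_ne_zero.2 h0))
  have hne : (𝓝[≠] (0:ℝ≥0∞)).NeBot := inferInstance
  have hev : ∀ᶠ τ in 𝓝[≠] (0:ℝ≥0∞), τ ≠ 0 := self_mem_nhdsWithin
  obtain ⟨τ, h0, h1, h2, h3⟩ := (hev.and ((small (b + 1) η (by finiteness) hη).and
    ((small (L * (b + 1)) (e / 2) (by finiteness) (by simp [he0])).and
      (small 1 1 (by finiteness) one_ne_zero)))).exists
  have hτt : τ ≠ ∞ := by
    intro h; rw [h] at h3; simp at h3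
  refine ⟨τ.toReal, ENNReal.toReal_pos h0 hτt, ?_⟩
  intro Q' hD' hQ' K' hK' hlt
  rw [ENNReal.ofReal_toReal hτt] at hlt
  obtain ⟨hG', -, η', L', hη', hL', H'⟩ := hK'
  obtain ⟨σ, g0, g1, g2, g3⟩ := (hev.and ((small 1 η' (by finiteness) hη').and
    ((small L' (e / 2) hL' (by simp [he0])).and (small 1 τ (by finiteness) h0)))).exists
  rw [one_mul] at g1 g3
  obtain ⟨h, hh, hd⟩ := nice_dense hp' (BQ_mem hQ') (dirac_anti hD') g0
  have hd1 : eLpNorm (fun s => Bmat * Q s - h s) p μ01 ≤ (b + 1) * τ := by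
    refine (eLp_tri hp (BQ_mem hQ).1 (BQ_mem hQ').1 (hh.1.memLp p).1).trans ?_
    rw [add_mul, one_mul]
    exact add_le_add ((BQ_sub p Q Q').trans (mul_le_mul' le_rfl hlt.le)) (hd.trans g3.le)
  have t1 : gpNorm p (fun x t => K x t - kK h x t) < e / 2 := by
    refine lt_of_le_of_lt ((H h hh (hd1.trans h1.le)).trans (mul_le_mul' le_rfl hd1)) ?_
    rwa [← mul_assoc]
  have t2 : gpNorm p (fun x t => kK h x t - K' x t) < e / 2 := by
    rw [gp_comm]
    exact lt_of_le_of_lt ((H' h hh (hd.trans g1.le)).trans (mul_le_mul' le_rfl hd)) g2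
  calc _ ≤ _ := gp_tri hp hG (kK_memGp hp hp' hh.1) hG'
    _ < e / 2 + e / 2 := ENNReal.add_lt_add t1 t2
    _ = e := ENNReal.add_halves e

end final

/-- The transformation-operator kernel `K_Q` lies in `G_p(M₂)` and
depends continuously on `Q ∈ L_p(M₂)`. -/
theorem statement3 (p : ℝ≥0∞) (hp : 1 ≤ p) (hp' : p ≠ ∞) :
    ∃ Kmap : (ℝ → M2) → ℝ → ℝ → M2,
      (∀ Q : ℝ → M2, IsDiracForm Q → MemLp Q p μ01 →
        IsTransfKernel Q (Kmap Q) ∧ MemGp p (Kmap Q)) ∧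
      (∀ Q : ℝ → M2, IsDiracForm Q → MemLp Q p μ01 → ∀ ε > (0:ℝ), ∃ δ > (0:ℝ),
        ∀ Q' : ℝ → M2, IsDiracForm Q' → MemLp Q' p μ01 →
          eLpNorm (fun x => Q x - Q' x) p μ01 < ENNReal.ofReal δ →
          gpNorm p (fun x t => Kmap Q x t - Kmap Q' x t) < ENNReal.ofReal ε) := by
  have hex : ∀ Q : ℝ → M2, ∃ K, IsDiracForm Q → MemLp Q p μ01 → Good p Q K := by
    intro Q
    by_cases h : IsDiracForm Q ∧ MemLp Q p μ01
    · obtain ⟨K, hK⟩ := limit_kernel hp hp' (BQ_mem h.2) (dirac_anti h.1)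
      exact ⟨K, fun _ _ => hK⟩
    · exact ⟨0, fun h1 h2 => absurd ⟨h1, h2⟩ h⟩
  choose Kmap hK using hex
  refine ⟨Kmap, fun Q hD hQ => ⟨?_, (hK Q hD hQ).1⟩, fun Q hD hQ ε hε => ?_⟩
  · obtain ⟨hG, hs, hl⟩ := hK Q hD hQ
    exact transf hp hp' (BQ_mem hQ) (dirac_anti hD) hG hs hl
  · obtain ⟨δ, hδ, H⟩ := good_cont hp hp' hQ (hK Q hD hQ) hε
    exact ⟨δ, hδ, fun Q' hD' hQ' hlt => H Q' hD' hQ' _ (hK Q' hD' hQ') hlt⟩
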